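/- arXiv:2106.09688 — 2 statements merged into one kernel-verified Lean document; each statement's English description precedes it below -/
import Mathlib

section
/- For every integer k ≥ 3 and every constant 1/k < η ≤ 1 there exists α > 0 such that the following holds for all sufficiently large n ∈ ℕ: every n-vertex graph G with minimum degree δ(G) ≥ ηn and independence number α(G) ≤ αn contains a C_k-tiling covering all but at most ⌊1/η⌋(k−1) vertices of G (an η-quasiperfect C_k-tiling), where C_k denotes the cycle on k vertices. -/
open Finset

namespace RTT

variable {k n : ℕ}

/-- `S` spans a copy of the `k`-vertex graph `F` in `G`:
there is an injective graph homomorphism from `F` to `G` with image exactly `S`. -/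
def SpansCopy (F : SimpleGraph (Fin k)) (G : SimpleGraph (Fin n))
    (S : Finset (Fin n)) : Prop :=
  ∃ f : Fin k → Fin n, Function.Injective f ∧
    (∀ a b, F.Adj a b → G.Adj (f a) (f b)) ∧ Finset.image f Finset.univ = S

/-- `T` is an `F`-tiling in `G`: a collection of pairwise vertex-disjoint vertex sets,
each spanning a copy of `F`. -/
def IsTiling (F : SimpleGraph (Fin k)) (G : SimpleGraph (Fin n))
    (T : Finset (Finset (Fin n))) : Prop :=
  (∀ S ∈ T, SpansCopy F G S) ∧ ∀ S ∈ T, ∀ S' ∈ T, S ≠ S' → Disjoint S S'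

/-- The induced subgraph of `G` on the vertex set `A` has a perfect `F`-tiling. -/
def PerfTilingOn (F : SimpleGraph (Fin k)) (G : SimpleGraph (Fin n))
    (A : Finset (Fin n)) : Prop :=
  ∃ T : Finset (Finset (Fin n)), IsTiling F G T ∧ T.biUnion id = A

/-- The minimum degree of `G` is at least `x`. -/
def MinDegGE (G : SimpleGraph (Fin n)) (x : ℝ) : Prop :=
  ∀ v : Fin n, x ≤ ((G.neighborSet v).ncard : ℝ)

/-- The `r`-independence number of `G` is at most `x`: every vertex set whose induced
subgraph contains no copy of `K_r` has size at most `x`. -/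
def IndepBound (G : SimpleGraph (Fin n)) (r : ℕ) (x : ℝ) : Prop :=
  ∀ S : Finset (Fin n), (∀ T ⊆ S, ¬ G.IsNClique r T) → (S.card : ℝ) ≤ x

/-- `α*(G) ≤ x`: every bipartite hole of `G` has size at most `x`. -/
def HoleBound (G : SimpleGraph (Fin n)) (x : ℝ) : Prop :=
  ∀ (s : ℕ) (U₁ U₂ : Finset (Fin n)), Disjoint U₁ U₂ → U₁.card = s → U₂.card = s →
    (∀ u ∈ U₁, ∀ v ∈ U₂, ¬ G.Adj u v) → (s : ℝ) ≤ x

/-- `A` is a `ξ`-absorbing set with respect to `V'` (for the `k`-vertex graph `F`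
in the `n`-vertex graph `G`). -/
def IsAbsorbingSet (F : SimpleGraph (Fin k)) (G : SimpleGraph (Fin n)) (ξ : ℝ)
    (V' A : Finset (Fin n)) : Prop :=
  ∀ U : Finset (Fin n), U ⊆ V' \ A → (U.card : ℝ) ≤ ξ * n →
    k ∣ (A ∪ U).card → PerfTilingOn F G (A ∪ U)

/-- `A` is an `(F,t)`-absorber for the `k`-set `S`. -/
def IsAbsorber (F : SimpleGraph (Fin k)) (G : SimpleGraph (Fin n)) (t : ℕ)
    (S A : Finset (Fin n)) : Prop :=
  Disjoint A S ∧ A.card ≤ k ^ 2 * t ∧ PerfTilingOn F G A ∧ PerfTilingOn F G (A ∪ S)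

/-- `S` has a family of at least `x` pairwise vertex-disjoint `(F,t)`-absorbers in `G`. -/
def HasManyAbsorbers (F : SimpleGraph (Fin k)) (G : SimpleGraph (Fin n)) (t : ℕ)
    (S : Finset (Fin n)) (x : ℝ) : Prop :=
  ∃ 𝒜 : Finset (Finset (Fin n)), x ≤ (𝒜.card : ℝ) ∧
    (∀ A ∈ 𝒜, IsAbsorber F G t S A) ∧
    ∀ A ∈ 𝒜, ∀ A' ∈ 𝒜, A ≠ A' → Disjoint A A'

/-- `𝒮` is an `F`-fan at `v` in `U`: a collection of pairwise disjoint `(k-1)`-sets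
`S ⊆ U \ {v}` such that `{v} ∪ S` spans a copy of `F`; its size is `𝒮.card`. -/
def IsFan (F : SimpleGraph (Fin k)) (G : SimpleGraph (Fin n)) (v : Fin n)
    (U : Finset (Fin n)) (𝒮 : Finset (Finset (Fin n))) : Prop :=
  (∀ S ∈ 𝒮, S ⊆ U.erase v ∧ S.card = k - 1 ∧ SpansCopy F G (insert v S)) ∧
    ∀ S ∈ 𝒮, ∀ S' ∈ 𝒮, S ≠ S' → Disjoint S S'

/-- `u` and `v` are `(F, m, t)`-reachable in `G`. -/
def FReachable (F : SimpleGraph (Fin k)) (G : SimpleGraph (Fin n)) (m : ℝ) (t : ℕ)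
    (u v : Fin n) : Prop :=
  ∀ W : Finset (Fin n), (W.card : ℝ) ≤ m →
    ∃ S : Finset (Fin n), Disjoint S W ∧ u ∉ S ∧ v ∉ S ∧ S.card ≤ k * t - 1 ∧
      PerfTilingOn F G (insert u S) ∧ PerfTilingOn F G (insert v S)

/-- `U` is `(F, m, t)`-closed in `G`. -/
def FClosed (F : SimpleGraph (Fin k)) (G : SimpleGraph (Fin n)) (m : ℝ) (t : ℕ)
    (U : Finset (Fin n)) : Prop :=
  ∀ u ∈ U, ∀ v ∈ U, u ≠ v → FReachable F G m t u v

/-- `P` is a partition of the vertex set of an `n`-vertex graph into `C` parts. -/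
def IsPartition {C : ℕ} (P : Fin C → Finset (Fin n)) : Prop :=
  (∀ i j, i ≠ j → Disjoint (P i) (P j)) ∧ Finset.univ.biUnion P = Finset.univ

/-- The `k`-vector `v` is `(F, β)`-robust with respect to the partition `P`:
it has coordinate sum `k`, and avoiding any set `W` of at most `βn` vertices there is
a copy of `F` whose vertex set has index vector `v`. -/
def RobustVec (F : SimpleGraph (Fin k)) (G : SimpleGraph (Fin n)) {C : ℕ}
    (P : Fin C → Finset (Fin n)) (β : ℝ) (v : Fin C → ℕ) : Prop :=
  (∑ i, v i) = k ∧
    ∀ W : Finset (Fin n), (W.card : ℝ) ≤ β * n →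
      ∃ S : Finset (Fin n), Disjoint S W ∧ SpansCopy F G S ∧ ∀ i, (S ∩ P i).card = v i

end RTT
namespace RTT

/-- Neighbourhood as a finset. -/
noncomputable def nb {n : ℕ} (G : SimpleGraph (Fin n)) (v : Fin n) : Finset (Fin n) :=
  (G.neighborSet v).toFinite.toFinset

lemma mem_nb {n : ℕ} {G : SimpleGraph (Fin n)} {v w : Fin n} : w ∈ nb G v ↔ G.Adj v w := by
  simp [nb]

/-- Perfect cycle tiling of a set. -/
abbrev Tl {n : ℕ} (k : ℕ) (G : SimpleGraph (Fin n)) (A : Finset (Fin n)) : Prop :=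
  PerfTilingOn (SimpleGraph.cycleGraph k) G A

/-- A cycle on the set. -/
abbrev Cy {n : ℕ} (k : ℕ) (G : SimpleGraph (Fin n)) (A : Finset (Fin n)) : Prop :=
  SpansCopy (SimpleGraph.cycleGraph k) G A

/-- Independence bound. -/
def Ind {n : ℕ} (G : SimpleGraph (Fin n)) (a : ℕ) : Prop :=
  ∀ S : Finset (Fin n), (∀ x ∈ S, ∀ y ∈ S, ¬ G.Adj x y) → S.card ≤ a

variable {k n : ℕ} {G : SimpleGraph (Fin n)}

lemma tl_empty : Tl k G ∅ := ⟨∅, ⟨by simp, by simp⟩, by simp⟩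

lemma tl_single {S : Finset (Fin n)} (h : Cy k G S) : Tl k G S :=
  ⟨{S}, ⟨by simpa using h, by simp⟩, by simp⟩

lemma cy_card {S : Finset (Fin n)} (h : Cy k G S) : S.card = k := by
  obtain ⟨f, hf, -, rfl⟩ := h
  rw [Finset.card_image_of_injective _ hf]; simp

lemma tl_union {A B : Finset (Fin n)} (hA : Tl k G A) (hB : Tl k G B) (hd : Disjoint A B) :
    Tl k G (A ∪ B) := by
  obtain ⟨T, ⟨hT1, hT2⟩, rfl⟩ := hA
  obtain ⟨T', ⟨hT1', hT2'⟩, rfl⟩ := hB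
  have key : ∀ S ∈ T, ∀ S' ∈ T', Disjoint S S' := by
    intro S hS S' hS'
    exact Finset.disjoint_of_subset_left (Finset.subset_biUnion_of_mem id hS)
      (Finset.disjoint_of_subset_right (Finset.subset_biUnion_of_mem id hS') hd)
  refine ⟨T ∪ T', ⟨?_, ?_⟩, ?_⟩
  · intro S hS
    rcases Finset.mem_union.1 hS with h | h
    exacts [hT1 S h, hT1' S h]
  · intro S hS S' hS' hne
    rcases Finset.mem_union.1 hS with h | h <;> rcases Finset.mem_union.1 hS' with h' | h'
    · exact hT2 S h S' h' hne
    · exact key S h S' h'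
    · exact (key S' h' S h).symm
    · exact hT2' S h S' h' hne
  · ext x; simp [Finset.mem_biUnion, or_and_right, exists_or]

lemma tl_union' {A B C : Finset (Fin n)} (hA : Tl k G A) (hB : Tl k G B) (hd : Disjoint A B)
    (h : C = A ∪ B) : Tl k G C := h ▸ tl_union hA hB hd

lemma cy_list (hk : 3 ≤ k) (L : List (Fin n)) (hlen : L.length = k) (hnd : L.Nodup)
    (hch : L.IsChain G.Adj) (hl : G.Adj (L[k - 1]'(by omega)) (L[0]'(by omega))) :
    Cy k G L.toFinset := by
  rw [List.isChain_iff_getElem] at hch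
  have key : ∀ a b : Fin k, (b - a).val = 1 →
      G.Adj (L[a.val]'(by omega)) (L[b.val]'(by omega)) := by
    intro a b hab
    have ha := a.2
    have hb := b.2
    rw [Fin.sub_def] at hab
    simp only at hab
    by_cases h : a.val < k - 1
    · have : b.val = a.val + 1 := by
        by_cases hab' : a.val ≤ b.val
        · have e : k - a.val + b.val = (b.val - a.val) + k := by omega
          rw [e, Nat.add_mod_right, Nat.mod_eq_of_lt (by omega)] at hab
          omega
        · rw [Nat.mod_eq_of_lt (by omega)] at hab
          omega
      have h2 := hch a.val (by omega)
      simpa [this] using h2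
    · have e : a.val = k - 1 := by omega
      have : b.val = 0 := by
        by_contra hb0
        have e : k - a.val + b.val = 1 + b.val := by omega
        by_cases hb1 : b.val = k - 1
        · rw [e, hb1, show 1 + (k - 1) = k by omega, Nat.mod_self] at hab
          omega
        · rw [e, Nat.mod_eq_of_lt (by omega)] at hab
          omega
      simpa [this, e] using hl
  refine ⟨fun i => L[i.val]'(by omega), ?_, ?_, ?_⟩
  · intro i j hij
    have := (List.Nodup.getElem_inj_iff hnd).1 hij
    exact Fin.ext this
  · intro a b hab
    rw [SimpleGraph.cycleGraph_adj'] at hab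
    rcases hab with h | h
    · exact (key b a h).symm
    · exact key a b h
  · ext x
    simp only [Finset.mem_image, Finset.mem_univ, true_and, List.mem_toFinset,
      List.mem_iff_getElem]
    constructor
    · rintro ⟨i, rfl⟩; exact ⟨i, by omega, rfl⟩
    · rintro ⟨i, hi, rfl⟩; exact ⟨⟨i, by omega⟩, rfl⟩

/-- Path lemma: large sets contain paths with `m+1` vertices. -/
lemma exists_path {a : ℕ} (hI : Ind G a) : ∀ (m : ℕ) (X : Finset (Fin n)), m * a < X.card →
    ∃ L : List (Fin n), L.length = m + 1 ∧ L.Nodup ∧ L.IsChain G.Adj ∧ ∀ x ∈ L, x ∈ X := by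
  intro m
  induction m with
  | zero =>
    intro X hX
    obtain ⟨x, hx⟩ := Finset.card_pos.1 (by omega : 0 < X.card)
    exact ⟨[x], by simp, by simp, by simp, by simpa using hx⟩
  | succ m ih =>
    intro X hX
    classical
    obtain ⟨I, hImem, hImax⟩ := Finset.exists_max_image
      (X.powerset.filter (fun S => ∀ x ∈ S, ∀ y ∈ S, ¬ G.Adj x y)) Finset.card
      ⟨∅, by simp⟩
    simp only [Finset.mem_filter, Finset.mem_powerset] at hImem hImax
    have hIc := hI I hImem.2
    have hc : m * a < (X \ I).card := by
      rw [Finset.card_sdiff_of_subset hImem.1]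
      have : (m + 1) * a = m * a + a := by ring
      omega
    obtain ⟨L, hl, hnd, hch, hX'⟩ := ih _ hc
    match L, hl, hnd, hch, hX' with
    | [], hl, _, _, _ => simp at hl
    | x :: L', hl, hnd, hch, hX' =>
      have hx := hX' x (by simp)
      rw [Finset.mem_sdiff] at hx
      have : ∃ y ∈ I, G.Adj y x := by
        by_contra hcon
        push Not at hcon
        have := hImax (insert x I) ⟨Finset.insert_subset hx.1 hImem.1, by
          intro u hu v hv huv
          rcases Finset.mem_insert.1 hu with hu | hu <;>
            rcases Finset.mem_insert.1 hv with hv | hv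
          · exact huv.ne (hu.trans hv.symm)
          · exact hcon v hv (hu ▸ huv.symm)
          · exact hcon u hu (hv ▸ huv)
          · exact hImem.2 u hu v hv huv⟩
        rw [Finset.card_insert_of_notMem hx.2] at this
        omega
      obtain ⟨y, hyI, hyx⟩ := this
      refine ⟨y :: x :: L', by simp at hl ⊢; omega, ?_, ?_, ?_⟩
      · rw [List.nodup_cons]
        refine ⟨fun hmem => ?_, hnd⟩
        exact (Finset.mem_sdiff.1 (hX' y hmem)).2 hyI
      · rw [List.isChain_cons_cons]; exact ⟨hyx, hch⟩
      · intro z hz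
        rcases List.mem_cons.1 hz with rfl | hz
        · exact hImem.1 hyI
        · exact (Finset.mem_sdiff.1 (hX' z hz)).1

/-- fan lemma: a large subset of the neighbourhood contains a `(k-1)`-set completing `v`. -/
lemma exists_fan (hk : 3 ≤ k) {a : ℕ} (hI : Ind G a) (v : Fin n) (X : Finset (Fin n))
    (hX : (k - 2) * a < X.card) (hv : X ⊆ nb G v) :
    ∃ P ⊆ X, P.card = k - 1 ∧ v ∉ P ∧ Cy k G (insert v P) := by
  obtain ⟨L, hl, hnd, hch, hLX⟩ := exists_path hI (k - 2) X hX
  have hadj : ∀ x ∈ L, G.Adj v x := fun x hx => mem_nb.1 (hv (hLX x hx))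
  have hvL : v ∉ L := fun h => (hadj v h).ne rfl
  have h1 : Cy k G (v :: L).toFinset := by
    refine cy_list hk _ (by simp; omega) (List.nodup_cons.2 ⟨hvL, hnd⟩) ?_ ?_
    · match L, hl, hadj, hch with
      | [], hl, _, _ => simp
      | x :: L', _, hadj, hch =>
        rw [List.isChain_cons_cons]; exact ⟨hadj x (by simp), hch⟩
    · have : ∃ j, k - 1 = j + 1 := ⟨k - 2, by omega⟩
      obtain ⟨j, hj⟩ := this
      simp only [hj, List.getElem_cons_succ, List.getElem_cons_zero]
      exact (hadj _ (List.getElem_mem _)).symm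
  refine ⟨L.toFinset, fun x hx => hLX x (by simpa using hx), ?_, by simpa using hvL, ?_⟩
  · rw [List.toFinset_card_of_nodup hnd]; omega
  · simpa using h1

end RTT
namespace RTT

variable {k n : ℕ} {G : SimpleGraph (Fin n)}

open Classical in
lemma card_nb_inter (v : Fin n) (B : Finset (Fin n)) :
    (nb G v ∩ B).card = ∑ x ∈ B, if G.Adj v x then 1 else 0 := by
  rw [← Finset.card_filter]
  congr 1
  ext x
  simp [mem_nb, and_comm]

lemma nb_dbl (A B : Finset (Fin n)) :
    ∑ v ∈ A, (nb G v ∩ B).card = ∑ x ∈ B, (nb G x ∩ A).card := by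
  classical
  simp only [card_nb_inter]
  rw [Finset.sum_comm]
  simp only [G.adj_comm]

lemma exists_codeg (X Y : Finset (Fin n)) (t : ℕ)
    (hg : n ^ 3 * (t + 1) < (∑ y ∈ Y, (nb G y ∩ X).card) ^ 2) :
    ∃ y ∈ Y, ∃ y' ∈ Y, y ≠ y' ∧ t < (nb G y ∩ nb G y' ∩ X).card := by
  classical
  by_contra hcon
  push Not at hcon
  have hXn : X.card ≤ n := by simpa using Finset.card_le_univ X
  have hYn : Y.card ≤ n := by simpa using Finset.card_le_univ Y
  have h1 : (∑ x ∈ X, (nb G x ∩ Y).card) ^ 2 ≤ X.card * ∑ x ∈ X, (nb G x ∩ Y).card ^ 2 :=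
    sq_sum_le_card_mul_sum_sq
  have h2 : ∑ x ∈ X, (nb G x ∩ Y).card ^ 2
      = ∑ y ∈ Y, ∑ y' ∈ Y, (nb G y ∩ nb G y' ∩ X).card := by
    have : ∀ y y', (nb G y ∩ nb G y' ∩ X).card
        = ∑ x ∈ X, (if G.Adj x y then 1 else 0) * (if G.Adj x y' then 1 else 0) := by
      intro y y'
      rw [← Finset.sum_filter_add_sum_filter_not X (fun x => x ∈ nb G y ∩ nb G y')]
      rw [Finset.card_eq_sum_ones]
      have e : (nb G y ∩ nb G y' ∩ X) = X.filter (fun x => x ∈ nb G y ∩ nb G y') := by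
        ext x; simp; tauto
      rw [e, Finset.sum_eq_zero (s := X.filter (fun x => ¬ x ∈ nb G y ∩ nb G y')), add_zero]
      · refine Finset.sum_congr rfl fun x hx => ?_
        simp only [Finset.mem_filter, Finset.mem_inter, mem_nb] at hx
        simp [hx.2.1.symm, hx.2.2.symm]
      · intro x hx
        simp only [Finset.mem_filter, Finset.mem_inter, mem_nb] at hx
        by_cases h : G.Adj x y
        · by_cases h' : G.Adj x y'
          · exact absurd ⟨h.symm, h'.symm⟩ hx.2
          · simp [h']
        · simp [h]
    simp only [this, card_nb_inter, sq, Finset.sum_mul_sum]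
    rw [Finset.sum_comm]
    refine Finset.sum_congr rfl fun y _ => ?_
    rw [Finset.sum_comm]
  have h3 : ∑ y ∈ Y, ∑ y' ∈ Y, (nb G y ∩ nb G y' ∩ X).card ≤ n * (n + n * t) := by
    calc _ ≤ ∑ y ∈ Y, (n + n * t) := by
          refine Finset.sum_le_sum fun y hy => ?_
          rw [← Finset.add_sum_erase _ _ hy]
          refine Nat.add_le_add ?_ ?_
          · simpa using Finset.card_le_univ (nb G y ∩ nb G y ∩ X)
          · calc _ ≤ ∑ y' ∈ Y.erase y, t :=
                  Finset.sum_le_sum fun y' hy' => hcon y hy y' (Finset.mem_of_mem_erase hy')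
                    (Finset.ne_of_mem_erase hy').symm
              _ ≤ n * t := by
                  rw [Finset.sum_const, smul_eq_mul]
                  exact Nat.mul_le_mul_right _ ((Finset.card_erase_le).trans hYn)
      _ ≤ _ := by
          rw [Finset.sum_const, smul_eq_mul]
          exact Nat.mul_le_mul_right _ hYn
  rw [nb_dbl] at hg
  have h4 : X.card * ∑ x ∈ X, (nb G x ∩ Y).card ^ 2 ≤ n * (n * (n + n * t)) := by
    rw [h2]; exact Nat.mul_le_mul hXn h3
  have h5 : n * (n * (n + n * t)) = n ^ 3 * (t + 1) := by ring
  omega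

lemma swap_ge4 (hk : 4 ≤ k) {a : ℕ} (hI : Ind G a) (X Y : Finset (Fin n))
    (hg : n ^ 3 * ((k - 2) * a + 1) < (∑ y ∈ Y, (nb G y ∩ X).card) ^ 2) :
    ∃ x ∈ X, ∃ y ∈ Y, ∃ S, S ⊆ X ∪ Y ∧ x ∉ S ∧ y ∉ S ∧ S.card ≤ k - 1 ∧
      Cy k G (insert x S) ∧ Cy k G (insert y S) := by
  obtain ⟨y, hy, y', hy', hne, hc⟩ := exists_codeg X Y _ hg
  obtain ⟨L, hl, hnd, hch, hLX⟩ := exists_path hI (k - 2) _ hc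
  have hLX' : ∀ x ∈ L, G.Adj y x ∧ G.Adj y' x ∧ x ∈ X := fun x hx => by
    have := hLX x hx
    simp only [Finset.mem_inter, mem_nb] at this
    exact ⟨this.1.1, this.1.2, this.2⟩
  have hyL : y ∉ L := fun h => (hLX' y h).1.ne rfl
  have hy'L : y' ∉ L := fun h => (hLX' y' h).2.1.ne rfl
  obtain ⟨p, L1, rfl⟩ : ∃ p L1, L = p :: L1 := by
    cases L with
    | nil => simp at hl
    | cons p L1 => exact ⟨p, L1, rfl⟩
  obtain ⟨L2, u, w, rfl⟩ : ∃ L2 u w, L1 = L2 ++ [u, w] := by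
    rcases List.eq_nil_or_concat L1 with rfl | ⟨L2, w, rfl⟩
    · simp at hl; omega
    rcases List.eq_nil_or_concat L2 with rfl | ⟨L3, u, rfl⟩
    · simp at hl; omega
    exact ⟨L3, u, w, by simp⟩
  have hlen : L2.length = k - 4 := by simp at hl; omega
  have hu := hLX' u (by simp)
  have hw := hLX' w (by simp)
  have hp := hLX' p (by simp)
  have hyall : y ≠ p ∧ y ∉ L2 ∧ y ≠ u ∧ y ≠ w := by simpa using hyL
  have hy'all : y' ≠ p ∧ y' ∉ L2 ∧ y' ≠ u ∧ y' ≠ w := by simpa using hy'L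
  have hnd2 := hnd
  have hch2 := hch
  rw [← List.cons_append] at hch2
  rw [List.isChain_append] at hch2
  have hpL2 : ∀ x ∈ p :: L2, x ∈ p :: (L2 ++ [u, w]) := by
    intro x hx; simp at hx ⊢; tauto
  have C1 : Cy k G (y :: p :: (L2 ++ [u, w])).toFinset := by
    refine cy_list (by omega) _ (by simp; omega) (List.nodup_cons.2 ⟨hyL, hnd⟩) ?_ ?_
    · rw [List.isChain_cons_cons]; exact ⟨hp.1, hch⟩
    · have : ∃ j, k - 1 = j + 1 := ⟨k - 2, by omega⟩
      obtain ⟨j, hj⟩ := this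
      simp only [hj, List.getElem_cons_succ (a := y), List.getElem_cons_zero]
      exact (hLX' _ (List.getElem_mem _)).1.symm
  have C2 : Cy k G (y :: p :: (L2 ++ [y', w])).toFinset := by
    refine cy_list (by omega) _ (by simp; omega) ?_ ?_ ?_
    · simp [List.nodup_cons, List.nodup_append] at hnd ⊢
      grind
    · rw [List.isChain_cons_cons]
      refine ⟨hp.1, ?_⟩
      rw [← List.cons_append, List.isChain_append]
      refine ⟨hch2.1, ?_, ?_⟩
      · simpa using hw.2.1
      · intro x hx z hz
        simp at hz
        subst hz
        exact (hLX' x (hpL2 x (List.mem_of_mem_getLast? hx))).2.1.symm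
    · have e : (y :: p :: (L2 ++ [y', w])) = (y :: p :: (L2 ++ [y'])) ++ [w] := by simp
      have : (y :: p :: (L2 ++ [y', w]))[k - 1]'(by simp; omega) = w := by
        simp only [e]
        rw [List.getElem_append_right (by simp; omega)]
        simp
      rw [this]
      exact hw.1.symm
  refine ⟨u, hu.2.2, y', hy', insert y (insert p (insert w L2.toFinset)), ?_, ?_, ?_, ?_, ?_, ?_⟩
  · intro x hx
    simp only [Finset.mem_insert, List.mem_toFinset, Finset.mem_union] at hx ⊢
    rcases hx with rfl | rfl | rfl | hx
    · exact Or.inr hy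
    · exact Or.inl hp.2.2
    · exact Or.inl hw.2.2
    · exact Or.inl (hLX' x (by simp [hx])).2.2
  · simp [List.nodup_cons, List.nodup_append] at hnd ⊢
    grind
  · simp
    grind
  · have h1 := Finset.card_insert_le y (insert p (insert w L2.toFinset))
    have h2 := Finset.card_insert_le p (insert w L2.toFinset)
    have h3 := Finset.card_insert_le w L2.toFinset
    have h4 := List.toFinset_card_le L2
    omega
  · convert C1 using 1
    ext x; simp; tauto
  · convert C2 using 1
    ext x; simp; tauto

lemma cy_three {x y z : Fin n} (h1 : G.Adj x y) (h2 : G.Adj y z) (h3 : G.Adj z x) :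
    Cy 3 G (insert x {y, z}) := by
  have := cy_list (k := 3) (G := G) le_rfl [x, y, z] rfl
    (by simp [h1.ne, h2.ne, h3.ne.symm]) (by simp [h1, h2]) (by simpa using h3)
  simpa using this

lemma swap_three {a : ℕ} (hI : Ind G a) (X Y : Finset (Fin n))
    (hg : 2 * n * a < ∑ y ∈ Y, (nb G y ∩ X).card) :
    ∃ x ∈ X, ∃ y ∈ Y, ∃ S, S ⊆ X ∪ Y ∧ x ∉ S ∧ y ∉ S ∧ S.card ≤ 3 - 1 ∧
      Cy 3 G (insert x S) ∧ Cy 3 G (insert y S) := by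
  classical
  by_contra hcon
  have hcon' : ∀ p ∈ X, ∀ q ∈ Y, G.Adj q p → ∀ x ∈ X, G.Adj q x → G.Adj p x →
      ∀ y ∈ Y, G.Adj p y → G.Adj q y → False := by
    intro p hp q hq hpq x hx hqx hpx y hy hpy hqy
    refine hcon ⟨x, hx, y, hy, {p, q}, ?_, ?_, ?_, Finset.card_le_two, ?_, ?_⟩
    · intro z hz; simp at hz ⊢; rcases hz with rfl | rfl <;> tauto
    · simp [hqx.ne', hpx.ne']
    · simp [hpy.ne', hqy.ne']
    · exact cy_three hpx.symm hpq.symm hqx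
    · exact cy_three hpy.symm hpq.symm hqy
  have hXn : X.card ≤ n := by simpa using Finset.card_le_univ X
  have hYn : Y.card ≤ n := by simpa using Finset.card_le_univ Y
  -- isolated vertices
  let I : Fin n → Finset (Fin n) → Finset (Fin n) := fun q X =>
    (nb G q ∩ X).filter (fun p => ∀ x ∈ X, G.Adj q x → ¬ G.Adj p x)
  have hIa : ∀ q X, (I q X).card ≤ a := by
    intro q X
    apply hI
    intro x hx y hy hxy
    simp only [I, Finset.mem_filter, Finset.mem_inter, mem_nb] at hx hy
    exact hx.2 y hy.1.2 hy.1.1 hxy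
  have h1 : ∀ q ∈ Y, (nb G q ∩ X).card ≤ a + (X.filter (fun p => q ∈ I p Y)).card := by
    intro q hq
    refine le_trans (Finset.card_le_card (t := I q X ∪ X.filter (fun p => q ∈ I p Y)) ?_)
      ((Finset.card_union_le _ _).trans (Nat.add_le_add_right (hIa q X) _))
    intro p hp
    simp only [I, Finset.mem_union, Finset.mem_filter, Finset.mem_inter, mem_nb] at hp ⊢
    by_cases h : ∀ x ∈ X, G.Adj q x → ¬ G.Adj p x
    · exact Or.inl ⟨hp, h⟩
    · right
      push Not at h
      obtain ⟨x, hx, hqx, hpx⟩ := h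
      refine ⟨hp.2, ⟨hp.1.symm, hq⟩, fun y hy hpy hqy => ?_⟩
      exact hcon' p hp.2 q hq hp.1 x hx hqx hpx y hy hpy hqy
  have h2 : ∑ q ∈ Y, (X.filter (fun p => q ∈ I p Y)).card
      = ∑ p ∈ X, (Y.filter (fun q => q ∈ I p Y)).card := by
    simp only [Finset.card_filter]
    exact Finset.sum_comm
  have h3 : ∑ p ∈ X, (Y.filter (fun q => q ∈ I p Y)).card ≤ n * a := by
    calc _ ≤ ∑ p ∈ X, a := Finset.sum_le_sum fun p _ =>
          le_trans (Finset.card_le_card (fun x hx => (Finset.mem_filter.1 hx).2)) (hIa p Y)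
      _ ≤ _ := by
          rw [Finset.sum_const, smul_eq_mul]; exact Nat.mul_le_mul_right _ hXn
  have h4 := Finset.sum_le_sum h1
  rw [Finset.sum_add_distrib, h2, Finset.sum_const, smul_eq_mul] at h4
  have h5 : Y.card * a ≤ n * a := Nat.mul_le_mul_right _ hYn
  have : 2 * n * a = n * a + n * a := by ring
  omega

lemma swap (hk : 3 ≤ k) {a : ℕ} (hI : Ind G a) (X Y : Finset (Fin n))
    (hg : n ^ 3 * ((k - 2) * a + 1) < (∑ y ∈ Y, (nb G y ∩ X).card) ^ 2)
    (hg' : 2 * n * a < ∑ y ∈ Y, (nb G y ∩ X).card) :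
    ∃ x ∈ X, ∃ y ∈ Y, ∃ S, S ⊆ X ∪ Y ∧ x ∉ S ∧ y ∉ S ∧ S.card ≤ k - 1 ∧
      Cy k G (insert x S) ∧ Cy k G (insert y S) := by
  rcases Nat.lt_or_ge 3 k with h | h
  · exact swap_ge4 h hI X Y hg
  · obtain rfl : k = 3 := by omega
    exact swap_three hI X Y hg'

end RTT
namespace RTT

variable {k n : ℕ} {G : SimpleGraph (Fin n)}

lemma tiling_card {T : Finset (Finset (Fin n))}
    (hT : IsTiling (SimpleGraph.cycleGraph k) G T) : k * T.card ≤ n := by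
  have h : (T.biUnion id).card = ∑ S ∈ T, S.card :=
    Finset.card_biUnion (fun S hS S' hS' hne => hT.2 S hS S' hS' hne)
  have h2 : ∑ S ∈ T, S.card = T.card * k := by
    rw [Finset.sum_congr rfl (fun S hS => cy_card (hT.1 S hS)), Finset.sum_const, smul_eq_mul]
  have h3 : (T.biUnion id).card ≤ n := by simpa using Finset.card_le_univ (T.biUnion id)
  rw [mul_comm]; omega

lemma max_tiling (hk : 3 ≤ k) {a : ℕ} (hI : Ind G a) (V2 : Finset (Fin n)) (h s : ℕ)
    (hdeg : ∀ v ∈ V2, h ≤ (nb G v ∩ V2).card)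
    (hnum : ∀ l, s < l → n * (l + k * (k * a + k)) + k * l * (k * a) < k * l * h) :
    ∃ T, IsTiling (SimpleGraph.cycleGraph k) G T ∧ (∀ S ∈ T, S ⊆ V2) ∧
      (V2 \ T.biUnion id).card ≤ s := by
  classical
  obtain ⟨T, hTm, hTmax⟩ := Finset.exists_max_image
    ((Finset.univ : Finset (Finset (Finset (Fin n)))).filter
      (fun T => IsTiling (SimpleGraph.cycleGraph k) G T ∧ ∀ S ∈ T, S ⊆ V2)) Finset.card
    ⟨∅, Finset.mem_filter.2 ⟨Finset.mem_univ _, ⟨by simp, by simp⟩, by simp⟩⟩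
  simp only [Finset.mem_filter, Finset.mem_univ, true_and] at hTm hTmax
  obtain ⟨hT, hTV⟩ := hTm
  refine ⟨T, hT, hTV, ?_⟩
  by_contra hcon
  push Not at hcon
  set L := V2 \ T.biUnion id with hL
  have hLd : ∀ S ∈ T, ∀ P ⊆ L, Disjoint S P := by
    intro S hS P hP
    rw [Finset.disjoint_left]
    intro x hx hxP
    have := hP hxP
    rw [hL, Finset.mem_sdiff] at this
    exact this.2 (Finset.mem_biUnion.2 ⟨S, hS, hx⟩)
  have hLV : L ⊆ V2 := Finset.sdiff_subset
  -- no vertex of L has many neighbours in L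
  have h1 : ∀ v ∈ L, (nb G v ∩ L).card ≤ (k - 2) * a := by
    intro v hv
    by_contra hc
    push Not at hc
    obtain ⟨P, hP, hPc, hvP, hCy⟩ := exists_fan hk hI v _ hc Finset.inter_subset_left
    have hsub : insert v P ⊆ L := Finset.insert_subset hv (hP.trans Finset.inter_subset_right)
    have hnot : insert v P ∉ T := by
      intro hmem
      have := hLd _ hmem _ hsub
      simp at this
    have := hTmax (insert (insert v P) T) ⟨⟨?_, ?_⟩, ?_⟩
    · rw [Finset.card_insert_of_notMem hnot] at this
      omega
    · intro S hS
      rcases Finset.mem_insert.1 hS with rfl | hS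
      exacts [hCy, hT.1 S hS]
    · intro S hS S' hS' hne
      rcases Finset.mem_insert.1 hS with e | hS <;> rcases Finset.mem_insert.1 hS' with e' | hS'
      · exact absurd (e.trans e'.symm) hne
      · rw [e]; exact (hLd S' hS' _ hsub).symm
      · rw [e']; exact hLd S hS _ hsub
      · exact hT.2 S hS S' hS' hne
    · intro S hS
      rcases Finset.mem_insert.1 hS with rfl | hS
      exacts [hsub.trans hLV, hTV S hS]
  set c := (k - 2) * a + (k - 1) with hc
  -- every tile has at most one vertex with many neighbours in L
  have h2 : ∀ S ∈ T, ∀ x ∈ S, ∀ x' ∈ S, x ≠ x' → c < (nb G x ∩ L).card →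
      (nb G x' ∩ L).card ≤ c := by
    intro S hS x hx x' hx' hne hxc
    by_contra hx'c
    push Not at hx'c
    obtain ⟨P, hP, hPc, hxP, hCy⟩ := exists_fan hk hI x (nb G x ∩ L) (by omega)
      Finset.inter_subset_left
    have hc2 : (k - 2) * a < ((nb G x' ∩ L) \ P).card := by
      have := Finset.le_card_sdiff P (nb G x' ∩ L)
      omega
    obtain ⟨P', hP', hPc', hxP', hCy'⟩ := exists_fan hk hI x' _ hc2
      (Finset.sdiff_subset.trans Finset.inter_subset_left)
    have hPL : P ⊆ L := hP.trans Finset.inter_subset_right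
    have hPL' : P' ⊆ L := hP'.trans (Finset.sdiff_subset.trans Finset.inter_subset_right)
    have hxL : ∀ y ∈ S, y ∉ L := fun y hy hyL =>
      Finset.disjoint_left.1 (hLd S hS L subset_rfl) hy hyL
    have hPP : Disjoint P P' := by
      rw [Finset.disjoint_left]
      intro y hy hy'
      exact (Finset.mem_sdiff.1 (hP' hy')).2 hy
    have hdis : Disjoint (insert x P) (insert x' P') := by
      rw [Finset.disjoint_insert_left, Finset.disjoint_insert_right]
      refine ⟨?_, fun h => hxL x' hx' (hPL h), hPP⟩
      simp only [Finset.mem_insert, not_or]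
      exact ⟨hne, fun h => hxL x hx (hPL' h)⟩
    have hd1 : ∀ S' ∈ T, S' ≠ S → ∀ y ∈ S, ∀ Q ⊆ L, Disjoint S' (insert y Q) := by
      intro S' hS' hne' y hy Q hQ
      rw [Finset.disjoint_insert_right]
      exact ⟨fun h => Finset.disjoint_left.1 (hT.2 S' hS' S hS hne') h hy, hLd S' hS' Q hQ⟩
    have hn1 : insert x P ∉ T.erase S := by
      intro hm
      have := hd1 _ (Finset.mem_of_mem_erase hm) (Finset.ne_of_mem_erase hm) x hx P hPL
      simp at this
    have hn2 : insert x' P' ∉ T.erase S := by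
      intro hm
      have := hd1 _ (Finset.mem_of_mem_erase hm) (Finset.ne_of_mem_erase hm) x' hx' P' hPL'
      simp at this
    have hn3 : insert x P ∉ insert (insert x' P') (T.erase S) := by
      rw [Finset.mem_insert, not_or]
      refine ⟨fun e => ?_, hn1⟩
      rw [e] at hdis
      simp at hdis
    have hsV : ∀ y ∈ S, ∀ Q ⊆ L, insert y Q ⊆ V2 := fun y hy Q hQ =>
      Finset.insert_subset (hTV S hS hy) (hQ.trans hLV)
    have := hTmax (insert (insert x P) (insert (insert x' P') (T.erase S))) ⟨⟨?_, ?_⟩, ?_⟩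
    · rw [Finset.card_insert_of_notMem hn3, Finset.card_insert_of_notMem hn2] at this
      have := Finset.card_erase_add_one hS
      omega
    · intro R hR
      rcases Finset.mem_insert.1 hR with rfl | hR
      · exact hCy
      rcases Finset.mem_insert.1 hR with rfl | hR
      · exact hCy'
      exact hT.1 R (Finset.mem_of_mem_erase hR)
    · intro R hR R' hR' hne'
      simp only [Finset.mem_insert, Finset.mem_erase] at hR hR'
      rcases hR with e | e | ⟨e1, e2⟩ <;> rcases hR' with e' | e' | ⟨e1', e2'⟩
      · exact absurd (e.trans e'.symm) hne'
      · rw [e, e']; exact hdis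
      · rw [e]; exact (hd1 R' e2' e1' x hx P hPL).symm
      · rw [e, e']; exact hdis.symm
      · exact absurd (e.trans e'.symm) hne'
      · rw [e]; exact (hd1 R' e2' e1' x' hx' P' hPL').symm
      · rw [e']; exact hd1 R e2 e1 x hx P hPL
      · rw [e']; exact hd1 R e2 e1 x' hx' P' hPL'
      · exact hT.2 R e2 R' e2' hne'
    · intro R hR
      simp only [Finset.mem_insert, Finset.mem_erase] at hR
      rcases hR with e | e | ⟨e1, e2⟩
      · rw [e]; exact hsV x hx P hPL
      · rw [e]; exact hsV x' hx' P' hPL'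
      · exact hTV R e2
  have h3 : ∀ S ∈ T, ∑ x ∈ S, (nb G x ∩ L).card ≤ L.card + k * c := by
    intro S hS
    have hSc := cy_card (hT.1 S hS)
    by_cases hex : ∃ x ∈ S, c < (nb G x ∩ L).card
    · obtain ⟨x, hx, hxc⟩ := hex
      rw [← Finset.add_sum_erase _ _ hx]
      refine Nat.add_le_add (Finset.card_le_card Finset.inter_subset_right) ?_
      calc _ ≤ ∑ x' ∈ S.erase x, c := Finset.sum_le_sum fun x' hx' =>
            h2 S hS x hx x' (Finset.mem_of_mem_erase hx') (Finset.ne_of_mem_erase hx').symm hxc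
        _ ≤ k * c := by
            rw [Finset.sum_const, smul_eq_mul]
            exact Nat.mul_le_mul_right _ (by rw [← hSc]; exact Finset.card_erase_le)
    · push Not at hex
      calc _ ≤ ∑ x' ∈ S, c := Finset.sum_le_sum hex
        _ = k * c := by rw [Finset.sum_const, smul_eq_mul, hSc]
        _ ≤ _ := Nat.le_add_left _ _
  have h4 : ∀ v ∈ L, h ≤ (k - 2) * a + ∑ S ∈ T, (nb G v ∩ S).card := by
    intro v hv
    have hsub : nb G v ∩ V2 ⊆ (nb G v ∩ L) ∪ T.biUnion (fun S => nb G v ∩ S) := by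
      intro x hx
      simp only [Finset.mem_inter, Finset.mem_union, Finset.mem_biUnion, hL, Finset.mem_sdiff,
        id] at hx ⊢
      by_cases hx' : ∃ S ∈ T, x ∈ S
      · obtain ⟨S, hS, hxS⟩ := hx'
        exact Or.inr ⟨S, hS, hx.1, hxS⟩
      · exact Or.inl ⟨hx.1, hx.2, hx'⟩
    calc h ≤ _ := hdeg v (hLV hv)
      _ ≤ _ := Finset.card_le_card hsub
      _ ≤ _ := Finset.card_union_le _ _
      _ ≤ _ := Nat.add_le_add (h1 v hv) Finset.card_biUnion_le
  have h5 := Finset.sum_le_sum h4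
  rw [Finset.sum_const, smul_eq_mul, Finset.sum_add_distrib, Finset.sum_const, smul_eq_mul,
    Finset.sum_comm] at h5
  have h6 : ∑ S ∈ T, ∑ v ∈ L, (nb G v ∩ S).card ≤ T.card * (L.card + k * c) := by
    calc _ = ∑ S ∈ T, ∑ x ∈ S, (nb G x ∩ L).card :=
          Finset.sum_congr rfl fun S _ => nb_dbl L S
      _ ≤ ∑ S ∈ T, (L.card + k * c) := Finset.sum_le_sum h3
      _ = _ := by rw [Finset.sum_const, smul_eq_mul]
  have h7 := hnum _ hcon
  have h8 : k * T.card ≤ n := tiling_card hT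
  have hka : (k - 2) * a ≤ k * a := Nat.mul_le_mul_right _ (by omega)
  have hcle : c ≤ k * a + k := by omega
  have h9 : k * L.card * h ≤ k * L.card * (k * a) + n * (L.card + k * (k * a + k)) := by
    calc k * L.card * h = k * (L.card * h) := by ring
      _ ≤ k * (L.card * ((k - 2) * a) + T.card * (L.card + k * c)) :=
          Nat.mul_le_mul_left _ (h5.trans (Nat.add_le_add_left h6 _))
      _ = k * L.card * ((k - 2) * a) + (k * T.card) * (L.card + k * c) := by ring
      _ ≤ _ := by gcongr
  omega

end RTT
namespace RTT

variable {k n : ℕ} {G : SimpleGraph (Fin n)}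

/-- Robust reachability. -/
def Reach (k : ℕ) (G : SimpleGraph (Fin n)) (m K : ℕ) (u v : Fin n) : Prop :=
  ∀ W : Finset (Fin n), W.card ≤ m → ∃ S : Finset (Fin n), Disjoint S W ∧ u ∉ S ∧ v ∉ S ∧
    S.card ≤ K ∧ Tl k G (insert u S) ∧ Tl k G (insert v S)

lemma Reach.symm {m K : ℕ} {u v : Fin n} (h : Reach k G m K u v) : Reach k G m K v u := by
  intro W hW
  obtain ⟨S, h1, h2, h3, h4, h5, h6⟩ := h W hW
  exact ⟨S, h1, h3, h2, h4, h6, h5⟩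

lemma Reach.mono {m K m' K' : ℕ} {u v : Fin n} (h : Reach k G m K u v) (hm : m' ≤ m)
    (hK : K ≤ K') : Reach k G m' K' u v := by
  intro W hW
  obtain ⟨S, h1, h2, h3, h4, h5, h6⟩ := h W (hW.trans hm)
  exact ⟨S, h1, h2, h3, h4.trans hK, h5, h6⟩

lemma reach_codeg (hk : 3 ≤ k) {a : ℕ} (hI : Ind G a) {m : ℕ} {u v : Fin n}
    (h : m + (k - 2) * a < (nb G u ∩ nb G v).card) : Reach k G m (k - 1) u v := by
  intro W hW
  have h1 : (k - 2) * a < ((nb G u ∩ nb G v) \ W).card := by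
    have := Finset.le_card_sdiff W (nb G u ∩ nb G v)
    omega
  obtain ⟨L, hl, hnd, hch, hLX⟩ := exists_path hI (k - 2) _ h1
  have hX : ∀ x ∈ L, G.Adj u x ∧ G.Adj v x ∧ x ∉ W := by
    intro x hx
    have := hLX x hx
    simp only [Finset.mem_sdiff, Finset.mem_inter, mem_nb] at this
    tauto
  have hw : ∀ w : Fin n, (∀ x ∈ L, G.Adj w x) → w ∉ L.toFinset ∧ Tl k G (insert w L.toFinset) := by
    intro w hadj
    have hvL : w ∉ L := fun h => (hadj w h).ne rfl
    refine ⟨by simpa using hvL, tl_single ?_⟩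
    have h1 : Cy k G (w :: L).toFinset := by
      refine cy_list hk _ (by simp; omega) (List.nodup_cons.2 ⟨hvL, hnd⟩) ?_ ?_
      · match L, hl, hadj, hch with
        | [], hl, _, _ => simp
        | x :: L', _, hadj, hch =>
          rw [List.isChain_cons_cons]; exact ⟨hadj x (by simp), hch⟩
      · have : ∃ j, k - 1 = j + 1 := ⟨k - 2, by omega⟩
        obtain ⟨j, hj⟩ := this
        simp only [hj, List.getElem_cons_succ, List.getElem_cons_zero]
        exact (hadj _ (List.getElem_mem _)).symm
    simpa using h1
  obtain ⟨hu1, hu2⟩ := hw u fun x hx => (hX x hx).1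
  obtain ⟨hv1, hv2⟩ := hw v fun x hx => (hX x hx).2.1
  refine ⟨L.toFinset, ?_, hu1, hv1, ?_, hu2, hv2⟩
  · rw [Finset.disjoint_left]
    intro x hx
    exact (hX x (by simpa using hx)).2.2
  · rw [List.toFinset_card_of_nodup hnd]; omega

/-- chaining two switches. -/
lemma reach_mid {m K : ℕ} {u w : Fin n} (huw : u ≠ w) (m' : ℕ) (I : Finset (Fin n))
    (hI : ∀ v ∈ I, Reach k G m K u v ∧ Reach k G m K v w)
    (h1 : m' + K + 2 ≤ m) (h2 : m' + 2 < I.card) : Reach k G m' (2 * K + 1) u w := by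
  intro W hW
  obtain ⟨v, hv⟩ : (I \ (insert u (insert w W))).Nonempty := by
    rw [← Finset.card_pos]
    have := Finset.le_card_sdiff (insert u (insert w W)) I
    have h3 := Finset.card_insert_le u (insert w W)
    have h4 := Finset.card_insert_le w W
    omega
  simp only [Finset.mem_sdiff, Finset.mem_insert, not_or] at hv
  obtain ⟨hvI, hvu, hvw, hvW⟩ := hv
  obtain ⟨S1, a1, a2, a3, a4, a5, a6⟩ := (hI v hvI).1 (insert w W)
    ((Finset.card_insert_le _ _).trans (by omega))
  obtain ⟨S2, b1, b2, b3, b4, b5, b6⟩ := (hI v hvI).2 (insert u (S1 ∪ W))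
    ((Finset.card_insert_le _ _).trans (by have := Finset.card_union_le S1 W; omega))
  simp only [Finset.disjoint_insert_right, Finset.disjoint_union_right] at a1 b1
  obtain ⟨a1, a1'⟩ := a1
  obtain ⟨b0, b1, b1'⟩ := b1
  refine ⟨insert v (S1 ∪ S2), ?_, ?_, ?_, ?_, ?_, ?_⟩
  · simp only [Finset.disjoint_insert_left, Finset.disjoint_union_left]
    exact ⟨hvW, a1', b1'⟩
  · simp only [Finset.mem_insert, Finset.mem_union, not_or]
    exact ⟨fun h => hvu h.symm, a2, b0⟩
  · simp only [Finset.mem_insert, Finset.mem_union, not_or]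
    exact ⟨fun h => hvw h.symm, a1, b3⟩
  · have h3 := Finset.card_insert_le v (S1 ∪ S2)
    have h4 := Finset.card_union_le S1 S2
    omega
  · refine tl_union' a5 b5 ?_ (by ext x; grind)
    simp only [Finset.disjoint_insert_left, Finset.disjoint_insert_right, Finset.mem_insert, not_or]
    exact ⟨⟨fun h => hvu h, a3⟩, b0, b1.symm⟩
  · refine tl_union' a6 b6 ?_ (by ext x; grind)
    simp only [Finset.disjoint_insert_left, Finset.disjoint_insert_right, Finset.mem_insert, not_or]
    exact ⟨⟨fun h => hvw h.symm, a1⟩, b2, b1.symm⟩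

/-- chaining through a swap. -/
lemma reach_swap {m K : ℕ} {u w : Fin n} (huw : u ≠ w) (m' : ℕ)
    (hS : ∀ W : Finset (Fin n), W.card ≤ m' + 2 → ∃ x y S, x ∉ W ∧ y ∉ W ∧ Disjoint S W ∧ x ∉ S ∧
      y ∉ S ∧ x ≠ y ∧ S.card ≤ K ∧ Cy k G (insert x S) ∧ Cy k G (insert y S) ∧
      Reach k G m K u x ∧ Reach k G m K y w)
    (h1 : m' + 2 * K + 3 ≤ m) : Reach k G m' (3 * K + 2) u w := by
  intro W hW
  obtain ⟨x, y, S, c1, c2, c3, c4, c5, c6, c7, c8, c9, hr1, hr2⟩ := hS (insert u (insert w W)) (by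
    have h3 := Finset.card_insert_le u (insert w W)
    have h4 := Finset.card_insert_le w W
    omega)
  simp only [Finset.disjoint_insert_right, Finset.mem_insert, not_or] at c1 c2 c3
  obtain ⟨S1, a1, a2, a3, a4, a5, a6⟩ := hr1 (insert w (insert y (S ∪ W))) (by
    have h3 := Finset.card_insert_le w (insert y (S ∪ W))
    have h4 := Finset.card_insert_le y (S ∪ W)
    have := Finset.card_union_le S W
    omega)
  obtain ⟨S2, b1, b2, b3, b4, b5, b6⟩ := hr2 (insert u (insert x (S1 ∪ (S ∪ W)))) (by
    have h3 := Finset.card_insert_le u (insert x (S1 ∪ (S ∪ W)))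
    have h4 := Finset.card_insert_le x (S1 ∪ (S ∪ W))
    have := Finset.card_union_le S W
    have := Finset.card_union_le S1 (S ∪ W)
    omega)
  simp only [Finset.disjoint_insert_right, Finset.disjoint_union_right] at a1 b1
  obtain ⟨aw, ay, aS, aW⟩ := a1
  obtain ⟨bu, bx, bS1, bS, bW⟩ := b1
  obtain ⟨xu, xw, xW⟩ := c1
  obtain ⟨yu, yw, yW⟩ := c2
  obtain ⟨Su, Sw, SW⟩ := c3
  refine ⟨S1 ∪ (insert x S) ∪ (insert y S2), ?_, ?_, ?_, ?_, ?_, ?_⟩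
  · simp only [Finset.disjoint_insert_left, Finset.disjoint_union_left]
    exact ⟨⟨aW, xW, SW⟩, yW, bW⟩
  · simp only [Finset.mem_insert, Finset.mem_union, not_or]
    exact ⟨⟨a2, fun h => xu h.symm, Su⟩, fun h => yu h.symm, bu⟩
  · simp only [Finset.mem_insert, Finset.mem_union, not_or]
    exact ⟨⟨aw, fun h => xw h.symm, Sw⟩, fun h => yw h.symm, b3⟩
  · have h3 := Finset.card_union_le (S1 ∪ (insert x S)) (insert y S2)
    have h4 := Finset.card_union_le S1 (insert x S)
    have h5 := Finset.card_insert_le x S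
    have h6 := Finset.card_insert_le y S2
    omega
  · refine tl_union' (tl_union a5 (tl_single c8) ?_) b5 ?_
      (by ext z; grind)
    · simp only [Finset.disjoint_insert_left, Finset.disjoint_insert_right, Finset.mem_insert,
        not_or]
      exact ⟨⟨xu, a3⟩, Su, aS⟩
    · simp only [Finset.disjoint_insert_left, Finset.disjoint_insert_right, Finset.mem_insert,
        not_or, Finset.disjoint_union_left, Finset.mem_union]
      exact ⟨⟨⟨yu, ay⟩, fun h => c6 h.symm, c5⟩, ⟨bu, bS1.symm⟩, bx, bS.symm⟩
  · refine tl_union' (tl_union a6 (tl_single c9) ?_) b6 ?_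
      (by ext z; grind)
    · simp only [Finset.disjoint_insert_left, Finset.disjoint_insert_right, Finset.mem_insert,
        not_or]
      exact ⟨⟨fun h => c6 h.symm, ay⟩, c4, aS⟩
    · simp only [Finset.disjoint_insert_left, Finset.disjoint_insert_right, Finset.mem_insert,
        not_or, Finset.disjoint_union_left, Finset.mem_union]
      exact ⟨⟨⟨fun h => xw h.symm, aw⟩, fun h => yw h.symm, Sw⟩, ⟨bx, bS1.symm⟩, b2, bS.symm⟩

end RTT
namespace RTT

variable {k n : ℕ} {G : SimpleGraph (Fin n)}

lemma multi_switch {m K : ℕ} (R : Fin n → Prop)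
    (hR : ∀ u v, R u → R v → u ≠ v → Reach k G m K u v) :
    ∀ (t : ℕ) (Q S W : Finset (Fin n)), Q.card = t → S.card = t → Disjoint Q S →
      (∀ x ∈ Q, R x) → (∀ x ∈ S, R x) → W.card + t * (K + 2) ≤ m →
      ∃ A, Disjoint A Q ∧ Disjoint A S ∧ Disjoint A W ∧ A.card ≤ t * K ∧
        Tl k G (Q ∪ A) ∧ Tl k G (S ∪ A) := by
  intro t
  induction t with
  | zero =>
    intro Q S W hQ hS _ _ _ _
    rw [Finset.card_eq_zero] at hQ hS
    subst hQ hS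
    exact ⟨∅, by simp, by simp, by simp, by simp, by simpa using tl_empty,
      by simpa using tl_empty⟩
  | succ t ih =>
    intro Q S W hQ hS hQS hQR hSR hW
    obtain ⟨q, hq⟩ := Finset.card_pos.1 (by omega : 0 < Q.card)
    obtain ⟨s, hs⟩ := Finset.card_pos.1 (by omega : 0 < S.card)
    have hqs : q ≠ s := fun e => Finset.disjoint_left.1 hQS hq (e ▸ hs)
    have hqS : q ∉ S := Finset.disjoint_left.1 hQS hq
    have hsQ : s ∉ Q := Finset.disjoint_right.1 hQS hs
    have e1 : (t + 1) * (K + 2) = t * (K + 2) + K + 2 := by ring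
    have e2 : t * (K + 2) = t * K + 2 * t := by ring
    have e3 : (t + 1) * K = t * K + K := by ring
    have hQe := Finset.card_erase_add_one hq
    have hSe := Finset.card_erase_add_one hs
    have i1 := Finset.card_insert_le q (insert s W)
    have i2 := Finset.card_insert_le s W
    obtain ⟨A, a1, a2, a3, a4, a5, a6⟩ := ih (Q.erase q) (S.erase s) (insert q (insert s W))
      (by omega) (by omega)
      (Finset.disjoint_of_subset_left (Finset.erase_subset _ _)
        (Finset.disjoint_of_subset_right (Finset.erase_subset _ _) hQS))
      (fun x hx => hQR x (Finset.mem_of_mem_erase hx))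
      (fun x hx => hSR x (Finset.mem_of_mem_erase hx)) (by omega)
    have u1 := Finset.card_union_le (Q ∪ S) (A ∪ W)
    have u2 := Finset.card_union_le Q S
    have u3 := Finset.card_union_le A W
    obtain ⟨B, b1, b2, b3, b4, b5, b6⟩ := hR q s (hQR q hq) (hSR s hs) hqs ((Q.erase q ∪ S.erase s) ∪ (A ∪ W)) (by
      have u1 := Finset.card_union_le (Q.erase q ∪ S.erase s) (A ∪ W)
      have u2 := Finset.card_union_le (Q.erase q) (S.erase s)
      have u3 := Finset.card_union_le A W
      omega)
    simp only [Finset.disjoint_insert_right, Finset.disjoint_union_right] at a3 b1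
    obtain ⟨aq, as, aW⟩ := a3
    obtain ⟨⟨bQ, bS⟩, bA, bW⟩ := b1
    have hQ' : Q = insert q (Q.erase q) := (Finset.insert_erase hq).symm
    have hS' : S = insert s (S.erase s) := (Finset.insert_erase hs).symm
    refine ⟨A ∪ B, ?_, ?_, ?_, ?_, ?_, ?_⟩
    · rw [hQ', Finset.disjoint_insert_right, Finset.disjoint_union_left, Finset.mem_union]
      exact ⟨by tauto, a1, bQ⟩
    · rw [hS', Finset.disjoint_insert_right, Finset.disjoint_union_left, Finset.mem_union]
      exact ⟨by tauto, a2, bS⟩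
    · rw [Finset.disjoint_union_left]; exact ⟨aW, bW⟩
    · have := Finset.card_union_le A B
      omega
    · refine tl_union' a5 b5 ?_ ?_
      · simp only [Finset.disjoint_insert_right, Finset.disjoint_union_left, Finset.mem_union]
        exact ⟨by simp [aq], bQ.symm, bA.symm⟩
      · conv_lhs => rw [hQ']
        ext x; simp only [Finset.mem_insert, Finset.mem_union]; tauto
    · refine tl_union' a6 b6 ?_ ?_
      · simp only [Finset.disjoint_insert_right, Finset.disjoint_union_left, Finset.mem_union]
        exact ⟨by simp [as], bS.symm, bA.symm⟩
      · conv_lhs => rw [hS']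
        ext x; simp only [Finset.mem_insert, Finset.mem_union]; tauto

lemma absorber {m K : ℕ} (R : Fin n → Prop)
    (hR : ∀ u v, R u → R v → u ≠ v → Reach k G m K u v)
    (hC : ∀ W : Finset (Fin n), W.card ≤ m → ∃ S, Cy k G S ∧ Disjoint S W ∧ ∀ x ∈ S, R x)
    (Q W : Finset (Fin n)) (hQ : Q.card = k) (hQR : ∀ x ∈ Q, R x)
    (hW : W.card + k * (K + 2) ≤ m) :
    ∃ A, Disjoint A Q ∧ Disjoint A W ∧ A.card ≤ k * (K + 1) ∧ Tl k G A ∧ Tl k G (Q ∪ A) := by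
  have u1 := Finset.card_union_le Q W
  have e : k * (K + 2) = k * K + k + k := by ring
  have e' : k * (K + 1) = k * K + k := by ring
  obtain ⟨S, s1, s2, s3⟩ := hC (Q ∪ W) (by omega)
  rw [Finset.disjoint_union_right] at s2
  obtain ⟨A, a1, a2, a3, a4, a5, a6⟩ := multi_switch R hR k Q S W hQ (cy_card s1) s2.1.symm hQR s3 hW
  refine ⟨S ∪ A, ?_, ?_, ?_, a6, ?_⟩
  · rw [Finset.disjoint_union_left]; exact ⟨s2.1, a1⟩
  · rw [Finset.disjoint_union_left]; exact ⟨s2.2, a3⟩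
  · have := Finset.card_union_le S A
    have := cy_card s1
    omega
  · refine tl_union' a5 (tl_single s1) ?_ ?_
    · rw [Finset.disjoint_union_left]; exact ⟨s2.1.symm, a2⟩
    · ext x; simp only [Finset.mem_union]; tauto

lemma universal {m K : ℕ} (R : Fin n → Prop)
    (hR : ∀ u v, R u → R v → u ≠ v → Reach k G m K u v)
    (hC : ∀ W : Finset (Fin n), W.card ≤ m → ∃ S, Cy k G S ∧ Disjoint S W ∧ ∀ x ∈ S, R x)
    (B W : Finset (Fin n)) (hBR : ∀ x ∈ B, R x) (F : Finset (Finset (Fin n))) :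
    (∀ Q ∈ F, Q ⊆ B ∧ Q.card = k) →
    W.card + B.card + F.card * (k * (K + 1)) + k * (K + 2) ≤ m →
    ∃ A, Disjoint A B ∧ Disjoint A W ∧ A.card ≤ F.card * (k * (K + 1)) ∧ Tl k G A ∧
      ∀ Q ∈ F, Tl k G (Q ∪ A) := by
  induction F using Finset.induction_on with
  | empty =>
    intro _ _
    exact ⟨∅, by simp, by simp, by simp, tl_empty, by simp⟩
  | insert Q F hQF ih =>
    intro hF hW
    rw [Finset.card_insert_of_notMem hQF] at hW ⊢
    have e : (F.card + 1) * (k * (K + 1)) = F.card * (k * (K + 1)) + k * (K + 1) := by ring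
    obtain ⟨A, a1, a2, a3, a4, a5⟩ := ih (fun Q' hQ' => hF Q' (Finset.mem_insert_of_mem hQ'))
      (by omega)
    obtain ⟨hQB, hQc⟩ := hF Q (Finset.mem_insert_self _ _)
    obtain ⟨A', b1, b2, b3, b4, b5⟩ := absorber R hR hC Q (B ∪ W ∪ A) hQc
      (fun x hx => hBR x (hQB hx)) (by
        have := Finset.card_union_le (B ∪ W) A
        have := Finset.card_union_le B W
        omega)
    simp only [Finset.disjoint_union_right] at b2
    obtain ⟨⟨bB, bW⟩, bA⟩ := b2
    refine ⟨A ∪ A', ?_, ?_, ?_, tl_union a4 b4 bA.symm, ?_⟩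
    · rw [Finset.disjoint_union_left]; exact ⟨a1, bB⟩
    · rw [Finset.disjoint_union_left]; exact ⟨a2, bW⟩
    · have := Finset.card_union_le A A'
      omega
    · intro Q' hQ'
      rcases Finset.mem_insert.1 hQ' with rfl | hQ'
      · refine tl_union' b5 a4 ?_ (by ext x; simp only [Finset.mem_union]; tauto)
        rw [Finset.disjoint_union_left]
        exact ⟨Finset.disjoint_of_subset_left hQB a1.symm, bA⟩
      · refine tl_union' (a5 Q' hQ') b4 ?_ (by ext x; simp only [Finset.mem_union]; tauto)
        rw [Finset.disjoint_union_left]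
        exact ⟨Finset.disjoint_of_subset_left
          (hF Q' (Finset.mem_insert_of_mem hQ')).1 bB.symm, bA.symm⟩

lemma absorb_chain (hk : 3 ≤ k) {m K : ℕ} (E : Finset (Fin n)) (c : Fin n → Fin n)
    (hR : ∀ u v, u ∉ E → v ∉ E → u ≠ v → c u = c v → Reach k G m K u v)
    (hC : ∀ u, u ∉ E → ∀ W : Finset (Fin n), W.card ≤ m →
      ∃ S, Cy k G S ∧ Disjoint S W ∧ ∀ x ∈ S, x ∉ E ∧ c x = c u)
    (Z : Finset (Fin n)) : ∀ W : Finset (Fin n),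
    (∀ z ∈ Z, z ∉ E) →
    W.card + Z.card * (k + 1 + 2 ^ (2 * k) * (k * (K + 1))) + k * (K + 2) + 2 * k ≤ m →
    ∃ A O : Finset (Fin n), Disjoint A Z ∧ Disjoint A W ∧
      A.card ≤ Z.card * (k + 2 ^ (2 * k) * (k * (K + 1))) ∧ O ⊆ A ∧ (∀ x ∈ O, x ∉ E) ∧
      (∀ i, (O.filter (fun x => c x = i)).card ≤ k - 1) ∧
      ∀ Z' ⊆ Z, ∃ X ⊆ O, Tl k G ((A ∪ Z') \ X) := by
  set g := 2 ^ (2 * k) * (k * (K + 1)) with hg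
  induction Z using Finset.induction_on with
  | empty =>
    intro W _ _
    refine ⟨∅, ∅, by simp, by simp, by simp, by simp, by simp, by simp, ?_⟩
    intro Z' hZ'
    refine ⟨∅, by simp, ?_⟩
    rw [Finset.subset_empty.1 hZ']
    simpa using tl_empty
  | insert z Z hzZ ih =>
    intro W hZE hW
    rw [Finset.card_insert_of_notMem hzZ] at hW ⊢
    have e1 : (Z.card + 1) * (k + 1 + g) = Z.card * (k + 1 + g) + (k + 1 + g) := by ring
    have e2 : (Z.card + 1) * (k + g) = Z.card * (k + g) + (k + g) := by ring
    have e3 : Z.card * (k + 1 + g) = Z.card * (k + g) + Z.card := by ring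
    have hzE : z ∉ E := hZE z (Finset.mem_insert_self _ _)
    have w1 := Finset.card_insert_le z W
    obtain ⟨A, O, a1, a2, a3, a4, a5, a6, a7⟩ := ih (insert z W)
      (fun x hx => hZE x (Finset.mem_insert_of_mem hx)) (by omega)
    rw [Finset.disjoint_insert_right] at a2
    obtain ⟨hzA, aW⟩ := a2
    set W' := insert z (Z ∪ W ∪ A) with hW'
    have w2 : W'.card ≤ Z.card + W.card + A.card + 1 := by
      have h1 := Finset.card_insert_le z (Z ∪ W ∪ A)
      have h2 := Finset.card_union_le (Z ∪ W) A
      have h3 := Finset.card_union_le Z W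
      rw [← hW'] at h1
      omega
    obtain ⟨S, s1, s2, s3⟩ := hC z hzE W' (by omega)
    obtain ⟨Y, hYS, hYc⟩ := Finset.exists_subset_card_eq (s := S) (n := k - 1)
      (by rw [cy_card s1]; omega)
    have hYW' : Disjoint Y W' := Finset.disjoint_of_subset_left hYS s2
    set Oi := O.filter (fun x => c x = c z) with hOi
    set B := insert z (Oi ∪ Y) with hB
    have hBR : ∀ x ∈ B, x ∉ E ∧ c x = c z := by
      intro x hx
      rw [hB, Finset.mem_insert, Finset.mem_union] at hx
      rcases hx with rfl | hx | hx
      · exact ⟨hzE, rfl⟩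
      · rw [hOi, Finset.mem_filter] at hx
        exact ⟨a5 x hx.1, hx.2⟩
      · exact s3 x (hYS hx)
    have hBc : B.card ≤ 2 * k - 1 := by
      have h1 := Finset.card_insert_le z (Oi ∪ Y)
      have h2 := Finset.card_union_le Oi Y
      have h3 := a6 (c z)
      rw [← hB] at h1
      rw [← hOi] at h3
      omega
    have hFc : (B.powersetCard k).card * (k * (K + 1)) ≤ g := by
      apply Nat.mul_le_mul_right
      rw [Finset.card_powersetCard]
      exact (Nat.choose_le_two_pow _ _).trans (Nat.pow_le_pow_right (by norm_num) (by omega))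
    obtain ⟨A', b1, b2, b3, b4, b5⟩ := universal (fun x => x ∉ E ∧ c x = c z)
      (fun u v hu hv huv => hR u v hu.1 hv.1 huv (hu.2.trans hv.2.symm)) (hC z hzE) B W' hBR
      (B.powersetCard k) (fun Q hQ => Finset.mem_powersetCard.1 hQ) (by omega)
    have hYp : ∀ x ∈ Y, x ≠ z ∧ x ∉ Z ∧ x ∉ W ∧ x ∉ A := by
      intro x hx
      have := Finset.disjoint_left.1 hYW' hx
      simp only [hW', Finset.mem_insert, Finset.mem_union, not_or] at this
      tauto
    have hA'p : ∀ x ∈ A', x ≠ z ∧ x ∉ Z ∧ x ∉ W ∧ x ∉ A ∧ x ∉ Y := by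
      intro x hx
      have h1 := Finset.disjoint_left.1 b2 hx
      have h2 := Finset.disjoint_left.1 b1 hx
      simp only [hW', hB, Finset.mem_insert, Finset.mem_union, not_or] at h1 h2
      tauto
    have hAZ : ∀ x ∈ A, x ∉ Z := fun x hx => Finset.disjoint_left.1 a1 hx
    have hAW : ∀ x ∈ A, x ∉ W := fun x hx => Finset.disjoint_left.1 aW hx
    refine ⟨A ∪ Y ∪ A', (O \ Oi) ∪ Y, ?_, ?_, ?_, ?_, ?_, ?_, ?_⟩
    · rw [Finset.disjoint_left]
      intro x hx hx'
      simp only [Finset.mem_union, Finset.mem_insert] at hx hx'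
      grind
    · rw [Finset.disjoint_left]
      intro x hx hx'
      simp only [Finset.mem_union] at hx
      grind
    · have h1 := Finset.card_union_le (A ∪ Y) A'
      have h2 := Finset.card_union_le A Y
      omega
    · intro x hx
      simp only [Finset.mem_union, Finset.mem_sdiff] at hx ⊢
      grind
    · intro x hx
      simp only [Finset.mem_union, Finset.mem_sdiff] at hx
      rcases hx with hx | hx
      · exact a5 x hx.1
      · exact (s3 x (hYS hx)).1
    · intro i
      by_cases hi : i = c z
      · refine le_trans (Finset.card_le_card (t := Y) ?_) hYc.le
        intro x hx
        simp only [Finset.mem_filter, Finset.mem_union, Finset.mem_sdiff, hOi] at hx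
        grind
      · refine le_trans (Finset.card_le_card ?_) (a6 i)
        intro x hx
        simp only [Finset.mem_filter, Finset.mem_union, Finset.mem_sdiff] at hx ⊢
        rcases hx with ⟨hx | hx, hxi⟩
        · exact ⟨hx.1, hxi⟩
        · exact absurd (hxi.symm.trans (s3 x (hYS hx)).2) hi
    · intro Z' hZ'
      obtain ⟨X, hXO, hX⟩ := a7 (Z'.erase z) (by
        intro x hx
        have h1 := hZ' (Finset.mem_of_mem_erase hx)
        exact (Finset.mem_insert.1 h1).resolve_left (Finset.ne_of_mem_erase hx))
      set Xi := X ∩ Oi with hXi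
      set Rr := Xi ∪ (Z' ∩ {z}) ∪ Y with hRr
      have hRB : Rr ⊆ B := by
        intro x hx
        simp only [hRr, hXi, hB, Finset.mem_union, Finset.mem_inter, Finset.mem_singleton,
          Finset.mem_insert] at hx ⊢
        tauto
      obtain ⟨X', hX'Y, hX'c⟩ := Finset.exists_subset_card_eq (s := Y) (n := Rr.card % k) (by
        have := Nat.mod_lt Rr.card (show 0 < k by omega)
        omega)
      have hX'R : X' ⊆ Rr := hX'Y.trans Finset.subset_union_right
      have hRc : (Rr \ X').card = k * (Rr.card / k) := by
        rw [Finset.card_sdiff_of_subset hX'R, hX'c]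
        have := Nat.div_add_mod Rr.card k
        omega
      have hRT : Tl k G ((Rr \ X') ∪ A') := by
        have hle : Rr.card ≤ 2 * k - 1 := (Finset.card_le_card hRB).trans hBc
        have hdiv : Rr.card / k < 2 := by
          rw [Nat.div_lt_iff_lt_mul (by omega)]; omega
        interval_cases hd : Rr.card / k
        · rw [mul_zero, Finset.card_eq_zero] at hRc
          rw [hRc]; simpa using b4
        · exact b5 _ (Finset.mem_powersetCard.2 ⟨Finset.sdiff_subset.trans hRB, by omega⟩)
      refine ⟨(X \ Oi) ∪ X', ?_, ?_⟩
      · intro x hx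
        simp only [Finset.mem_union, Finset.mem_sdiff] at hx ⊢
        rcases hx with hx | hx
        · exact Or.inl ⟨hXO hx.1, hx.2⟩
        · exact Or.inr (hX'Y hx)
      · have hOiA : ∀ x ∈ Oi, x ∈ A := fun x hx => a4 (Finset.mem_filter.1 hx).1
        have hXA : ∀ x ∈ X, x ∈ A := fun x hx => a4 (hXO hx)
        have hZ'p : ∀ x ∈ Z', x = z ∨ x ∈ Z := fun x hx => Finset.mem_insert.1 (hZ' hx)
        have hX'p : ∀ x ∈ X', x ∈ Y := fun x hx => hX'Y hx
        refine tl_union' hX hRT ?_ ?_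
        · rw [Finset.disjoint_left]
          intro x hx hx'
          simp only [hRr, hXi, Finset.mem_union, Finset.mem_inter, Finset.mem_singleton,
            Finset.mem_sdiff, Finset.mem_erase] at hx hx'
          clear_value Oi
          grind
        · ext x
          simp only [hRr, hXi, Finset.mem_union, Finset.mem_inter, Finset.mem_singleton,
            Finset.mem_sdiff, Finset.mem_erase]
          have p1 := hYp x
          have p2 := hA'p x
          have p3 := hAZ x
          have p4 := hOiA x
          have p5 := hXA x
          have p6 := hZ'p x
          have p7 := hX'p x
          have p8 : z ∉ Z := hzZ
          have p9 : z ∉ A := hzA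
          clear_value Oi
          clear hYp hA'p hAZ hOiA hXA hZ'p hX'p hR hC ih hW hZE e1 e2 e3 w1 a3 a6 a7 w2 s3 hBR hBc hFc b5 hX hRT hRc
          by_cases hxz : x = z
          · subst hxz
            clear hRr hXi hOi hB hW'
            grind
          · clear hRr hXi hOi hB hW'
            grind

end RTT
namespace RTT

variable {k n : ℕ} {G : SimpleGraph (Fin n)}

lemma bonf (q : ℕ) (D : Finset (Fin n)) :
    (∀ u ∈ D, ∀ v ∈ D, u ≠ v → (nb G u ∩ nb G v).card ≤ q) →
    ∑ v ∈ D, (nb G v).card ≤ (D.biUnion (nb G)).card + D.card ^ 2 * q := by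
  induction D using Finset.induction_on with
  | empty => simp
  | insert v D hv ih =>
    intro h
    have h1 := ih (fun u hu w hw => h u (Finset.mem_insert_of_mem hu) w (Finset.mem_insert_of_mem hw))
    rw [Finset.sum_insert hv, Finset.biUnion_insert, Finset.card_insert_of_notMem hv]
    have h2 : (nb G v ∩ D.biUnion (nb G)).card ≤ D.card * q := by
      rw [Finset.inter_biUnion]
      refine Finset.card_biUnion_le.trans ?_
      rw [← smul_eq_mul]
      refine Finset.sum_le_card_nsmul _ _ _ (fun w hw => ?_)
      exact h v (Finset.mem_insert_self _ _) w (Finset.mem_insert_of_mem hw)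
        (fun e => hv (e ▸ hw))
    have h3 := Finset.card_union_add_card_inter (nb G v) (D.biUnion (nb G))
    have h4 : (D.card + 1) ^ 2 * q = D.card ^ 2 * q + 2 * (D.card * q) + q := by ring
    omega

lemma pair_codeg (q h C : ℕ) (hdeg : ∀ v, h ≤ (nb G v).card) (D : Finset (Fin n))
    (hD : D.card = C + 1) (hq : n + (C + 1) ^ 2 * q < (C + 1) * h) :
    ∃ u ∈ D, ∃ v ∈ D, u ≠ v ∧ q < (nb G u ∩ nb G v).card := by
  by_contra hcon
  push Not at hcon
  have h1 := bonf q D hcon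
  have h2 : D.card * h ≤ ∑ v ∈ D, (nb G v).card := by
    rw [← smul_eq_mul]
    exact Finset.card_nsmul_le_sum _ _ _ (fun v _ => hdeg v)
  have h3 := Finset.card_le_univ (D.biUnion (nb G))
  rw [Fintype.card_fin] at h3
  rw [hD] at h1 h2
  omega

lemma level_select (hn : 0 < n) (C : ℕ) (R : ℕ → Fin n → Fin n → Prop)
    (h0 : ∀ D : Finset (Fin n), D.card = C + 1 → ∃ u ∈ D, ∃ v ∈ D, u ≠ v ∧ R 0 u v) :
    ∃ d l, d ≤ C ∧ l < C ∧ ∃ D : Finset (Fin n), D.card = d ∧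
      (∀ u ∈ D, ∀ v ∈ D, u ≠ v → ¬ R (l + 1) u v) ∧
      ∀ D' : Finset (Fin n), D'.card = d + 1 → ∃ u ∈ D', ∃ v ∈ D', u ≠ v ∧ R l u v := by
  classical
  by_contra hcon
  push Not at hcon
  have key : ∀ d, d ≤ C → ∃ D : Finset (Fin n), D.card = d + 1 ∧
      ∀ u ∈ D, ∀ v ∈ D, u ≠ v → ¬ R (C - d) u v := by
    intro d
    induction d with
    | zero =>
      intro _
      refine ⟨{⟨0, hn⟩}, by simp, ?_⟩
      intro u hu v hv huv
      rw [Finset.mem_singleton] at hu hv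
      exact absurd (hu.trans hv.symm) huv
    | succ d ih =>
      intro hd
      obtain ⟨D, hD1, hD2⟩ := ih (by omega)
      have e : C - d = (C - (d + 1)) + 1 := by omega
      rw [e] at hD2
      obtain ⟨D', h1, h2⟩ := hcon (d + 1) (C - (d + 1)) hd (by omega) D hD1 hD2
      exact ⟨D', h1, h2⟩
  obtain ⟨D, h1, h2⟩ := key C le_rfl
  obtain ⟨u, hu, v, hv, huv, hr⟩ := h0 D h1
  rw [Nat.sub_self] at h2
  exact h2 u hu v hv huv hr

lemma colour (R R' : Fin n → Fin n → Prop) (hsymm : ∀ u v, R u v → R v u)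
    (hmono : ∀ u v, R u v → R' u v) (s d : ℕ)
    (hmid : ∀ u w, u ≠ w → ∀ I : Finset (Fin n), (∀ v ∈ I, R u v ∧ R v w) → s < I.card → R' u w)
    (D : Finset (Fin n)) (hD : D.card = d)
    (hDR : ∀ u ∈ D, ∀ v ∈ D, u ≠ v → ¬ R' u v)
    (hmax : ∀ D' : Finset (Fin n), D'.card = d + 1 → ∃ u ∈ D', ∃ v ∈ D', u ≠ v ∧ R u v) :
    ∃ (E : Finset (Fin n)) (c : Fin n → Fin n), E.card ≤ d * d * s ∧ (∀ u, c u ∈ D) ∧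
      (∀ u, u = c u ∨ R u (c u)) ∧
      (∀ u v, u ∉ E → v ∉ E → u ≠ v → c u = c v → R u v) := by
  classical
  have hc : ∀ u, ∃ v ∈ D, u = v ∨ R u v := by
    intro u
    by_cases hu : u ∈ D
    · exact ⟨u, hu, Or.inl rfl⟩
    · obtain ⟨x, hx, y, hy, hxy, hr⟩ := hmax (insert u D)
        (by rw [Finset.card_insert_of_notMem hu, hD])
      rw [Finset.mem_insert] at hx hy
      rcases hx with rfl | hx
      · rcases hy with rfl | hy
        · exact absurd rfl hxy
        · exact ⟨y, hy, Or.inr hr⟩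
      · rcases hy with rfl | hy
        · exact ⟨x, hx, Or.inr (hsymm _ _ hr)⟩
        · exact absurd (hmono _ _ hr) (hDR x hx y hy hxy)
  choose c hcD hc using hc
  set E := (D.offDiag).biUnion (fun p => (univ : Finset (Fin n)).filter
    (fun u => (u = p.1 ∨ R u p.1) ∧ (u = p.2 ∨ R u p.2))) with hE
  have hEm : ∀ u, u ∉ E → ∀ v ∈ D, ∀ w ∈ D, (u = v ∨ R u v) → (u = w ∨ R u w) → v = w := by
    intro u hu v hv w hw h1 h2
    by_contra hne
    apply hu
    rw [hE, Finset.mem_biUnion]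
    exact ⟨(v, w), Finset.mem_offDiag.2 ⟨hv, hw, hne⟩, by simp [h1, h2]⟩
  refine ⟨E, c, ?_, hcD, hc, ?_⟩
  · refine Finset.card_biUnion_le.trans ?_
    refine (Finset.sum_le_card_nsmul _ _ s ?_).trans ?_
    · rintro ⟨v, w⟩ hp
      obtain ⟨hv, hw, hne⟩ := Finset.mem_offDiag.1 hp
      by_contra hcon
      push Not at hcon
      refine hDR v hv w hw hne (hmid v w hne _ ?_ hcon)
      intro u hu
      simp only [Finset.mem_filter, Finset.mem_univ, true_and] at hu
      obtain ⟨h1, h2⟩ := hu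
      rcases h1 with rfl | h1
      · rcases h2 with rfl | h2
        · exact absurd rfl hne
        · exact absurd (hmono _ _ h2) (hDR u hv w hw hne)
      · rcases h2 with rfl | h2
        · exact absurd (hmono _ _ (hsymm _ _ h1)) (hDR v hv u hw hne)
        · exact ⟨hsymm _ _ h1, h2⟩
    · rw [smul_eq_mul]
      apply Nat.mul_le_mul_right
      rw [Finset.offDiag_card, hD]
      omega
  · intro u u' hu hu' huu hcc
    rcases hc u with h1 | h1
    · rcases hc u' with h2 | h2
      · exact absurd (h1.trans (hcc.trans h2.symm)) huu
      · rw [← hcc, ← h1] at h2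
        exact hsymm _ _ h2
    · rcases hc u' with h2 | h2
      · rw [hcc, ← h2] at h1
        exact h1
      · by_cases e1 : u = c u
        · rw [← hcc, ← e1] at h2
          exact hsymm _ _ h2
        by_cases e2 : u' = c u'
        · rw [hcc, ← e2] at h1
          exact h1
        have n1 : u ∉ D := fun h => e1 (hEm u hu u h (c u) (hcD u) (Or.inl rfl) (Or.inr h1))
        have n2 : u' ∉ D := fun h => e2 (hEm u' hu' u' h (c u') (hcD u') (Or.inl rfl) (Or.inr h2))
        have hcard := Finset.card_erase_add_one (hcD u)
        obtain ⟨x, hx, y, hy, hxy, hr⟩ := hmax (insert u (insert u' (D.erase (c u)))) (by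
          rw [Finset.card_insert_of_notMem, Finset.card_insert_of_notMem]
          · omega
          · simp [n2]
          · simp [n1, huu])
        have k1 : ∀ w ∈ D.erase (c u), ¬ R u w := fun w hw hR =>
          (Finset.mem_erase.1 hw).1 (hEm u hu w (Finset.mem_erase.1 hw).2 (c u) (hcD u)
            (Or.inr hR) (Or.inr h1))
        have k2 : ∀ w ∈ D.erase (c u), ¬ R u' w := fun w hw hR =>
          (Finset.mem_erase.1 hw).1 (hEm u' hu' w (Finset.mem_erase.1 hw).2 (c u) (hcD u)
            (Or.inr hR) (Or.inr (hcc ▸ h2)))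
        have k3 : ∀ w ∈ D.erase (c u), ∀ z ∈ D.erase (c u), w ≠ z → ¬ R w z := fun w hw z hz hwz hR =>
          hDR w (Finset.mem_erase.1 hw).2 z (Finset.mem_erase.1 hz).2 hwz (hmono _ _ hR)
        rw [Finset.mem_insert, Finset.mem_insert] at hx hy
        rcases hx with rfl | rfl | hx <;> rcases hy with rfl | rfl | hy
        · exact absurd rfl hxy
        · exact hr
        · exact absurd hr (k1 _ hy)
        · exact hsymm _ _ hr
        · exact absurd rfl hxy
        · exact absurd hr (k2 _ hy)
        · exact absurd (hsymm _ _ hr) (k1 _ hx)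
        · exact absurd (hsymm _ _ hr) (k2 _ hx)
        · exact absurd hr (k3 _ hx _ hy hxy)

lemma sum_sdiff_bound (X Y W : Finset (Fin n)) :
    ∑ y ∈ Y, (nb G y ∩ X).card ≤ ∑ y ∈ Y \ W, (nb G y ∩ (X \ W)).card + 2 * W.card * n := by
  have hle : ∀ S : Finset (Fin n), S.card ≤ n := fun S => by
    simpa using Finset.card_le_univ S
  have h1 : ∑ y ∈ Y, (nb G y ∩ X).card ≤
      ∑ y ∈ Y \ W, (nb G y ∩ X).card + ∑ y ∈ W, (nb G y ∩ X).card := by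
    rw [← Finset.sum_union Finset.sdiff_disjoint]
    apply Finset.sum_le_sum_of_subset
    intro y hy
    simp only [Finset.mem_union, Finset.mem_sdiff]
    tauto
  have h2 : ∑ y ∈ W, (nb G y ∩ X).card ≤ W.card * n := by
    rw [← smul_eq_mul]
    exact Finset.sum_le_card_nsmul _ _ _ (fun y _ => hle _)
  have h3 : ∑ y ∈ Y \ W, (nb G y ∩ X).card ≤
      ∑ y ∈ Y \ W, ((nb G y ∩ (X \ W)).card + W.card) := by
    apply Finset.sum_le_sum
    intro y _
    refine (Finset.card_le_card (t := (nb G y ∩ (X \ W)) ∪ W) ?_).trans (Finset.card_union_le _ _)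
    intro z hz
    simp only [Finset.mem_union, Finset.mem_sdiff, Finset.mem_inter] at hz ⊢
    tauto
  rw [Finset.sum_add_distrib, Finset.sum_const, smul_eq_mul] at h3
  have h4 : (Y \ W).card * W.card ≤ n * W.card := Nat.mul_le_mul_right _ (hle _)
  have h5 : W.card * n = n * W.card := mul_comm _ _
  have h6 : 2 * W.card * n = 2 * (n * W.card) := by ring
  omega

lemma cross (hk : 3 ≤ k) {a m m' K g : ℕ} (hI : Ind G a) (hK : k - 1 ≤ K)
    (hm : m' + 2 * K + 3 ≤ m) (c : Fin n → Fin n)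
    (hc : ∀ u, u = c u ∨ Reach k G m K u (c u)) (v v' : Fin n) (hv : v ≠ v')
    (X Y : Finset (Fin n)) (hX : ∀ x ∈ X, c x = v) (hY : ∀ y ∈ Y, c y = v')
    (hn : ¬ Reach k G m' (3 * K + 2) v v')
    (hg : n ^ 3 * ((k - 2) * a + 1) < g ^ 2) (hg' : 2 * n * a < g) :
    ∑ y ∈ Y, (nb G y ∩ X).card ≤ g + 2 * (m' + 4) * n := by
  classical
  by_contra hcon
  push Not at hcon
  apply hn
  refine reach_swap (m := m) hv m' ?_ hm
  intro W hW
  have hWc : (insert v (insert v' W)).card ≤ m' + 4 := by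
    have := Finset.card_insert_le v (insert v' W)
    have := Finset.card_insert_le v' W
    omega
  have h1 := sum_sdiff_bound (G := G) X Y (insert v (insert v' W))
  have h2 : 2 * (insert v (insert v' W)).card * n ≤ 2 * (m' + 4) * n :=
    Nat.mul_le_mul_right _ (Nat.mul_le_mul_left _ hWc)
  set W' := insert v (insert v' W) with hW'
  have h3 : g < ∑ y ∈ Y \ W', (nb G y ∩ (X \ W')).card := by omega
  obtain ⟨x, hx, y, hy, S, s1, s2, s3, s4, s5, s6⟩ := swap hk hI (X \ W') (Y \ W')
    (hg.trans_le (Nat.pow_le_pow_left h3.le 2)) (hg'.trans h3)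
  have hWW : ∀ z, z ∉ W' → z ≠ v ∧ z ≠ v' ∧ z ∉ W := by
    intro z hz
    simp only [hW', Finset.mem_insert, not_or] at hz
    exact hz
  obtain ⟨hxX, hxW⟩ := Finset.mem_sdiff.1 hx
  obtain ⟨hyY, hyW⟩ := Finset.mem_sdiff.1 hy
  have hx2 := hX x hxX
  have hy2 := hY y hyY
  refine ⟨x, y, S, (hWW x hxW).2.2, (hWW y hyW).2.2, ?_, s2, s3, ?_, s4.trans hK, s5, s6, ?_, ?_⟩
  · rw [Finset.disjoint_left]
    intro z hz
    have := s1 hz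
    simp only [Finset.mem_union, Finset.mem_sdiff] at this
    rcases this with h | h
    · exact (hWW z h.2).2.2
    · exact (hWW z h.2).2.2
  · rintro rfl
    exact hv (hx2.symm.trans hy2)
  · rcases hc x with h | h
    · exact absurd (h.trans hx2) (hWW x hxW).1
    · rw [hx2] at h
      exact h.symm
  · rcases hc y with h | h
    · exact absurd (h.trans hy2) (hWW y hyW).2.1
    · rw [hy2] at h
      exact h

end RTT
namespace RTT

variable {k n : ℕ} {G : SimpleGraph (Fin n)}

lemma big_class (hk : 3 ≤ k) {a : ℕ} (hI : Ind G a) (h C m g t e : ℕ)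
    (hdeg : ∀ v, h ≤ (nb G v).card) (c : Fin n → Fin n) (D E : Finset (Fin n))
    (hDC : D.card ≤ C) (hcD : ∀ u, c u ∈ D) (hE : E.card ≤ e)
    (hcross : ∀ v ∈ D, ∀ v' ∈ D, v ≠ v' →
      ∑ y ∈ univ.filter (fun u => u ∉ E ∧ c u = v'),
        (nb G y ∩ univ.filter (fun u => u ∉ E ∧ c u = v)).card ≤ g)
    (hnum : C * g < (t - m) * (h - ((k - 2) * a + m + e)))
    (v : Fin n) (hv : v ∈ D) (ht : t ≤ (univ.filter (fun u => u ∉ E ∧ c u = v)).card)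
    (W : Finset (Fin n)) (hW : W.card ≤ m) :
    ∃ S, Cy k G S ∧ Disjoint S W ∧ ∀ x ∈ S, x ∉ E ∧ c x = v := by
  classical
  set X := univ.filter (fun u => u ∉ E ∧ c u = v) with hX
  have hXm : ∀ x, x ∈ X ↔ x ∉ E ∧ c x = v := fun x => by simp [hX]
  by_cases hex : ∃ x ∈ X \ W, (k - 2) * a < (nb G x ∩ (X \ W)).card
  · obtain ⟨x, hx, hxc⟩ := hex
    obtain ⟨P, hP, -, -, hcy⟩ := exists_fan hk hI x _ hxc Finset.inter_subset_left
    have hall : ∀ z ∈ insert x P, z ∈ X \ W := by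
      intro z hz
      rcases Finset.mem_insert.1 hz with rfl | hz
      · exact hx
      · exact (Finset.mem_inter.1 (hP hz)).2
    refine ⟨insert x P, hcy, ?_, ?_⟩
    · rw [Finset.disjoint_left]
      exact fun z hz => (Finset.mem_sdiff.1 (hall z hz)).2
    · exact fun z hz => (hXm z).1 (Finset.mem_sdiff.1 (hall z hz)).1
  · exfalso
    push Not at hex
    set q := (k - 2) * a + m + e with hq
    have hpt : ∀ x ∈ X \ W, h ≤ q + ∑ w ∈ D.erase v,
        (nb G x ∩ univ.filter (fun u => u ∉ E ∧ c u = w)).card := by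
      intro x hx
      have h1 := hex x hx
      have hsub : nb G x ⊆ ((nb G x ∩ (X \ W)) ∪ W ∪ E) ∪
          (D.erase v).biUnion (fun w => nb G x ∩ univ.filter (fun u => u ∉ E ∧ c u = w)) := by
        intro z hz
        by_cases hzE : z ∈ E
        · simp [hzE]
        by_cases hzW : z ∈ W
        · simp [hzW]
        by_cases hzv : c z = v
        · have : z ∈ X := (hXm z).2 ⟨hzE, hzv⟩
          simp [hz, this, hzW]
        · apply Finset.mem_union_right
          rw [Finset.mem_biUnion]
          exact ⟨c z, Finset.mem_erase.2 ⟨hzv, hcD z⟩, by simp [hz, hzE]⟩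
      have h2 := Finset.card_le_card hsub
      have h3 := Finset.card_union_le ((nb G x ∩ (X \ W)) ∪ W ∪ E)
          ((D.erase v).biUnion (fun w => nb G x ∩ univ.filter (fun u => u ∉ E ∧ c u = w)))
      have h4 := Finset.card_union_le ((nb G x ∩ (X \ W)) ∪ W) E
      have h5 := Finset.card_union_le (nb G x ∩ (X \ W)) W
      have h6 : ((D.erase v).biUnion
          (fun w => nb G x ∩ univ.filter (fun u => u ∉ E ∧ c u = w))).card ≤ _ :=
        Finset.card_biUnion_le
      have h7 := hdeg x
      omega
    have hsum : (X \ W).card * h ≤ (X \ W).card * q + C * g := by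
      calc (X \ W).card * h = ∑ x ∈ X \ W, h := by rw [Finset.sum_const, smul_eq_mul]
        _ ≤ ∑ x ∈ X \ W, (q + ∑ w ∈ D.erase v,
              (nb G x ∩ univ.filter (fun u => u ∉ E ∧ c u = w)).card) := Finset.sum_le_sum hpt
        _ = (X \ W).card * q + ∑ w ∈ D.erase v, ∑ x ∈ X \ W,
              (nb G x ∩ univ.filter (fun u => u ∉ E ∧ c u = w)).card := by
            rw [Finset.sum_add_distrib, Finset.sum_const, smul_eq_mul, Finset.sum_comm]
        _ ≤ (X \ W).card * q + C * g := by
            apply Nat.add_le_add_left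
            refine (Finset.sum_le_card_nsmul _ _ g ?_).trans ?_
            · intro w hw
              obtain ⟨hw1, hw2⟩ := Finset.mem_erase.1 hw
              refine le_trans (Finset.sum_le_sum_of_subset Finset.sdiff_subset) (hcross w hw2 v hv hw1)
            · rw [smul_eq_mul]
              apply Nat.mul_le_mul_right
              exact (Finset.card_le_card (Finset.erase_subset _ _)).trans hDC
    have hXW : t - m ≤ (X \ W).card := by
      have := Finset.le_card_sdiff W X
      omega
    have h8 : (t - m) * (h - q) ≤ (X \ W).card * (h - q) := Nat.mul_le_mul_right _ hXW
    rw [Nat.mul_sub (X \ W).card] at h8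
    omega

lemma structure_lemma (hk : 3 ≤ k) {a : ℕ} (hI : Ind G a) (hn : 0 < n) (h C m M K g t : ℕ)
    (hdeg : ∀ v, h ≤ (nb G v).card)
    (hK : K = 3 ^ C * k) (hM : M = m + C * (2 * K + 3))
    (h1 : n + (C + 1) ^ 2 * (M + (k - 2) * a) < (C + 1) * h)
    (h2 : n ^ 3 * ((k - 2) * a + 1) < g ^ 2) (h3 : 2 * n * a < g)
    (h4 : C * (g + 2 * (M + 4) * n) <
      (t - m) * (h - ((k - 2) * a + m + C * C * (M + 2)))) :
    ∃ (E : Finset (Fin n)) (c : Fin n → Fin n) (D : Finset (Fin n)),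
      D.card ≤ C ∧ (∀ u, c u ∈ D) ∧ E.card ≤ C * C * (M + 2) + C * t ∧
      (∀ u v, u ∉ E → v ∉ E → u ≠ v → c u = c v → Reach k G m K u v) ∧
      (∀ u, u ∉ E → ∀ W : Finset (Fin n), W.card ≤ m →
        ∃ S, Cy k G S ∧ Disjoint S W ∧ ∀ x ∈ S, x ∉ E ∧ c x = c u) := by
  classical
  set lm : ℕ → ℕ := fun l => m + (C - l) * (2 * K + 3) with hlm
  set lK : ℕ → ℕ := fun l => 3 ^ l * k - 1 with hlK
  have p1 : ∀ l, 1 ≤ 3 ^ l := fun l => Nat.one_le_pow _ _ (by norm_num)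
  have p2 : ∀ l, k ≤ 3 ^ l * k := fun l => Nat.le_mul_of_pos_left k (p1 l)
  have hKs : ∀ l, lK (l + 1) = 3 * lK l + 2 := by
    intro l
    have := p2 l
    simp only [hlK]
    have e : 3 ^ (l + 1) * k = 3 * (3 ^ l * k) := by ring
    omega
  have hKle : ∀ l, l ≤ C → lK l ≤ K := by
    intro l hl
    have : 3 ^ l * k ≤ 3 ^ C * k := Nat.mul_le_mul_right _ (Nat.pow_le_pow_right (by norm_num) hl)
    simp only [hlK]
    omega
  have hms : ∀ l, l < C → lm (l + 1) + (2 * K + 3) = lm l := by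
    intro l hl
    simp only [hlm]
    have e : C - l = (C - (l + 1)) + 1 := by omega
    rw [e]; ring
  have hm0 : lm 0 = M := by simp only [hlm, hM, Nat.sub_zero]
  have hmM : ∀ l, lm l ≤ M := by
    intro l
    have : (C - l) * (2 * K + 3) ≤ C * (2 * K + 3) := Nat.mul_le_mul_right _ (Nat.sub_le _ _)
    simp only [hlm]
    omega
  have hmm : ∀ l, m ≤ lm l := fun l => Nat.le_add_right _ _
  obtain ⟨d, l, hdC, hlC, D, hDd, hDR, hmax⟩ := level_select hn C
    (fun l => Reach k G (lm l) (lK l)) (by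
      intro D hD
      obtain ⟨u, hu, v, hv, huv, hq⟩ := pair_codeg (M + (k - 2) * a) h C hdeg D hD h1
      refine ⟨u, hu, v, hv, huv, ?_⟩
      have : lK 0 = k - 1 := by simp [hlK]
      simp only [hm0, this]
      exact reach_codeg hk hI hq)
  have hml := hms l hlC
  have hKl := hKle l hlC.le
  obtain ⟨E', c, hE', hcD, hc, hcR⟩ := colour (Reach k G (lm l) (lK l))
    (Reach k G (lm (l + 1)) (lK (l + 1))) (fun u v hr => hr.symm)
    (fun u v hr => hr.mono (by omega) (by rw [hKs]; omega)) (M + 2) d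
    (by
      intro u w huw I hII hIc
      have hx := reach_mid huw (lm (l + 1)) I hII (by omega) (by have := hmM (l + 1); omega)
      exact hx.mono le_rfl (by rw [hKs]; omega)) D hDd hDR hmax
  have hE'' : E'.card ≤ C * C * (M + 2) :=
    hE'.trans (Nat.mul_le_mul_right _ (Nat.mul_le_mul hdC hdC))
  set Sm := (D.filter (fun v => (univ.filter (fun u => u ∉ E' ∧ c u = v)).card < t)).biUnion
    (fun v => univ.filter (fun u => u ∉ E' ∧ c u = v)) with hSm
  have hSmm : ∀ u, u ∉ E' → (u ∉ Sm ↔ t ≤ (univ.filter (fun x => x ∉ E' ∧ c x = c u)).card) := by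
    intro u hu
    rw [hSm, Finset.mem_biUnion]
    constructor
    · intro hx
      by_contra hcon
      push Not at hcon
      exact hx ⟨c u, Finset.mem_filter.2 ⟨hcD u, hcon⟩, by simp [hu]⟩
    · rintro hx ⟨v, hv, huv⟩
      simp only [Finset.mem_filter, Finset.mem_univ, true_and] at huv
      rw [huv.2] at hx
      have := (Finset.mem_filter.1 hv).2
      omega
  refine ⟨E' ∪ Sm, c, D, by omega, hcD, ?_, ?_, ?_⟩
  · have u1 := Finset.card_union_le E' Sm
    have u2 : Sm.card ≤ C * t := by
      refine Finset.card_biUnion_le.trans ((Finset.sum_le_card_nsmul _ _ t ?_).trans ?_)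
      · intro v hv
        exact (Finset.mem_filter.1 hv).2.le
      · rw [smul_eq_mul]
        apply Nat.mul_le_mul_right
        exact (Finset.card_filter_le _ _).trans (by omega)
    omega
  · intro u v hu hv huv hcc
    rw [Finset.mem_union, not_or] at hu hv
    exact (hcR u v hu.1 hv.1 huv hcc).mono (hmm l) hKl
  · intro u hu W hW
    rw [Finset.mem_union, not_or] at hu
    have ht := (hSmm u hu.1).1 hu.2
    obtain ⟨S, s1, s2, s3⟩ := big_class hk hI h C m (g + 2 * (M + 4) * n) t (C * C * (M + 2)) hdeg c D E'
      (by omega) hcD hE'' (by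
        intro v hv v' hv' hvv
        have := cross hk (m := lm l) (m' := lm (l + 1)) (K := lK l) (g := g) hI
          (by have := p2 l; simp only [hlK]; omega) (by omega) c hc v v' hvv
          (univ.filter (fun u => u ∉ E' ∧ c u = v)) (univ.filter (fun u => u ∉ E' ∧ c u = v'))
          (by simp) (by simp) (by rw [← hKs]; exact hDR v hv v' hv' hvv) h2 h3
        refine this.trans ?_
        have := hmM (l + 1)
        gcongr) h4 (c u) (hcD u) ht W hW
    refine ⟨S, s1, s2, ?_⟩
    intro x hx
    obtain ⟨hx1, hx2⟩ := s3 x hx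
    refine ⟨?_, hx2⟩
    rw [Finset.mem_union, not_or]
    refine ⟨hx1, (hSmm x hx1).2 ?_⟩
    rw [hx2]; exact ht

end RTT
namespace RTT

variable {k n : ℕ} {G : SimpleGraph (Fin n)}

lemma chunk_card (P c : ℕ) (hP : 0 < P) :
    ((univ : Finset (Fin n)).filter (fun w => w.val % P = c)).card ≤ n / P + 1 := by
  have h := Finset.card_le_card_of_injOn (s := (univ : Finset (Fin n)).filter (fun w => w.val % P = c))
    (t := Finset.range (n / P + 1)) (fun w => w.val / P) (by
      intro w _
      simp only [Finset.coe_range, Set.mem_Iio]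
      have := Nat.div_le_div_right (c := P) w.2.le
      omega) (by
      intro x hx y hy hxy
      simp only [Finset.coe_filter, Finset.mem_univ, true_and, Set.mem_setOf_eq] at hx hy
      simp only at hxy
      apply Fin.ext
      rw [← Nat.div_add_mod x.val P, ← Nat.div_add_mod y.val P, hx, hy, hxy])
  simpa using h

lemma one_chunk (P q τ : ℕ) (hP : 0 < P) (E B : Finset (Fin n))
    (hB : ∀ v ∈ B, q ≤ (nb G v \ E).card) :
    ∃ Y : Finset (Fin n), Disjoint Y E ∧ Y.card ≤ n / P + 1 ∧
      B.card * q ≤ P * (τ * B.card + (n / P + 1) *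
        (B.filter (fun v => τ ≤ (nb G v ∩ Y).card)).card) := by
  classical
  set Y : ℕ → Finset (Fin n) := fun c =>
    ((univ : Finset (Fin n)).filter (fun w => w.val % P = c)) \ E with hY
  have hYc : ∀ c, (Y c).card ≤ n / P + 1 := fun c =>
    (Finset.card_le_card Finset.sdiff_subset).trans (chunk_card P c hP)
  have h1 : B.card * q ≤ ∑ c ∈ Finset.range P, ∑ v ∈ B, (nb G v ∩ Y c).card := by
    rw [Finset.sum_comm, ← smul_eq_mul]
    refine Finset.card_nsmul_le_sum _ _ _ (fun v hv => (hB v hv).trans ?_)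
    refine (Finset.card_le_card (t := (Finset.range P).biUnion (fun c => nb G v ∩ Y c)) ?_).trans
      Finset.card_biUnion_le
    intro w hw
    rw [Finset.mem_sdiff] at hw
    rw [Finset.mem_biUnion]
    exact ⟨w.val % P, Finset.mem_range.2 (Nat.mod_lt _ hP), by simp [hY, hw.1, hw.2]⟩
  obtain ⟨c, hc, hmax⟩ := Finset.exists_max_image (Finset.range P)
    (fun c => ∑ v ∈ B, (nb G v ∩ Y c).card) ⟨0, Finset.mem_range.2 hP⟩
  have h2 := Finset.sum_le_card_nsmul _ _ _ hmax
  rw [Finset.card_range, smul_eq_mul] at h2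
  refine ⟨Y c, Finset.sdiff_disjoint, hYc c, (h1.trans h2).trans (Nat.mul_le_mul_left _ ?_)⟩
  rw [← Finset.sum_filter_add_sum_filter_not B (fun v => τ ≤ (nb G v ∩ Y c).card), add_comm]
  apply Nat.add_le_add
  · refine (Finset.sum_le_card_nsmul _ _ τ ?_).trans ?_
    · intro v hv
      have := (Finset.mem_filter.1 hv).2
      omega
    · rw [smul_eq_mul, mul_comm]
      exact Nat.mul_le_mul_left _ (Finset.card_filter_le _ _)
  · refine (Finset.sum_le_card_nsmul _ _ (n / P + 1) ?_).trans ?_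
    · intro v hv
      exact (Finset.card_le_card Finset.inter_subset_right).trans (hYc c)
    · rw [smul_eq_mul, mul_comm]

lemma reservoir (P q τ : ℕ) (hP : 0 < P) (E : Finset (Fin n)) (ρ : ℝ) (hρ : 0 ≤ ρ)
    (hB : ∀ v, q ≤ (nb G v \ E).card)
    (hnum : ∀ b g : ℕ, b * q ≤ P * (τ * b + (n / P + 1) * g) → (b : ℝ) - g ≤ ρ * b) (j : ℕ) :
    ∃ Z : Finset (Fin n), Disjoint Z E ∧ Z.card ≤ j * (n / P + 1) ∧
      (((univ : Finset (Fin n)).filter (fun v => (nb G v ∩ Z).card < τ)).card : ℝ) ≤ ρ ^ j * n := by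
  classical
  induction j with
  | zero =>
    refine ⟨∅, by simp, by simp, ?_⟩
    rw [pow_zero, one_mul]
    exact_mod_cast (Finset.card_le_univ _).trans (by simp)
  | succ j ih =>
    obtain ⟨Z, z1, z2, z3⟩ := ih
    set B := (univ : Finset (Fin n)).filter (fun v => (nb G v ∩ Z).card < τ) with hBd
    obtain ⟨Y, y1, y2, y3⟩ := one_chunk P q τ hP E B (fun v _ => hB v)
    have h1 := hnum _ _ y3
    refine ⟨Z ∪ Y, ?_, ?_, ?_⟩
    · rw [Finset.disjoint_union_left]; exact ⟨z1, y1⟩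
    · have := Finset.card_union_le Z Y
      rw [add_mul]; omega
    · have hsub : (univ : Finset (Fin n)).filter (fun v => (nb G v ∩ (Z ∪ Y)).card < τ) ⊆
          B \ B.filter (fun v => τ ≤ (nb G v ∩ Y).card) := by
        intro v hv
        simp only [hBd, Finset.mem_filter, Finset.mem_univ, true_and, Finset.mem_sdiff, not_and,
          not_le] at hv ⊢
        have e1 : (nb G v ∩ Z).card ≤ (nb G v ∩ (Z ∪ Y)).card :=
          Finset.card_le_card (Finset.inter_subset_inter_left Finset.subset_union_left)
        have e2 : (nb G v ∩ Y).card ≤ (nb G v ∩ (Z ∪ Y)).card :=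
          Finset.card_le_card (Finset.inter_subset_inter_left Finset.subset_union_right)
        exact ⟨by omega, fun _ => by omega⟩
      have h2 := Finset.card_le_card hsub
      rw [Finset.card_sdiff_of_subset (Finset.filter_subset _ _)] at h2
      have h3 := Finset.card_filter_le B (fun v => τ ≤ (nb G v ∩ Y).card)
      have h4 : (((univ : Finset (Fin n)).filter (fun v => (nb G v ∩ (Z ∪ Y)).card < τ)).card : ℝ) ≤
          B.card - (B.filter (fun v => τ ≤ (nb G v ∩ Y).card)).card := by
        rw [← Nat.cast_sub h3]
        exact_mod_cast h2
      calc _ ≤ _ := h4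
        _ ≤ ρ * B.card := h1
        _ ≤ ρ * (ρ ^ j * n) := by gcongr
        _ = ρ ^ (j + 1) * n := by ring

lemma greedy (hk : 3 ≤ k) {a : ℕ} (hI : Ind G a) (s : ℕ) (Q B : Finset (Fin n)) :
    Disjoint B Q → B.card ≤ s → (∀ v ∈ B, (k - 2) * a + (k - 1) * s < (nb G v ∩ Q).card) →
    ∃ U ⊆ Q, U.card ≤ (k - 1) * B.card ∧ Tl k G (B ∪ U) := by
  classical
  induction B using Finset.induction_on with
  | empty =>
    intro _ _ _
    exact ⟨∅, by simp, by simp, by simpa using tl_empty⟩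
  | insert v B hv ih =>
    intro hd hs hdeg
    rw [Finset.card_insert_of_notMem hv] at hs ⊢
    rw [Finset.disjoint_insert_left] at hd
    obtain ⟨U, u1, u2, u3⟩ := ih hd.2 (by omega) (fun w hw => hdeg w (Finset.mem_insert_of_mem hw))
    have h1 := hdeg v (Finset.mem_insert_self _ _)
    have h2 : (k - 1) * B.card ≤ (k - 1) * s := Nat.mul_le_mul_left _ (by omega)
    have h3 := Finset.le_card_sdiff U (nb G v ∩ Q)
    obtain ⟨P, p1, p2, p3, p4⟩ := exists_fan hk hI v ((nb G v ∩ Q) \ U) (by omega)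
      (Finset.sdiff_subset.trans Finset.inter_subset_left)
    have hPm : ∀ x ∈ P, x ∈ Q ∧ x ∉ U := by
      intro x hx
      have := p1 hx
      simp only [Finset.mem_sdiff, Finset.mem_inter] at this
      exact ⟨this.1.2, this.2⟩
    refine ⟨U ∪ P, ?_, ?_, ?_⟩
    · exact Finset.union_subset u1 (fun x hx => (hPm x hx).1)
    · have := Finset.card_union_le U P
      rw [mul_add]; omega
    · refine tl_union' u3 (tl_single p4) ?_ ?_
      · rw [Finset.disjoint_left]
        intro x hx hx'
        rw [Finset.mem_union] at hx
        rw [Finset.mem_insert] at hx'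
        rcases hx' with rfl | hx'
        · rcases hx with hx | hx
          · exact hv hx
          · exact hd.1 (u1 hx)
        · rcases hx with hx | hx
          · exact Finset.disjoint_left.1 hd.2 hx (hPm x hx').1
          · exact (hPm x hx').2 hx
      · grind

lemma assemble (hk : 3 ≤ k) {a : ℕ} (hI : Ind G a) (h w b τ s : ℕ)
    (hdeg : ∀ v, h ≤ (nb G v).card) (Z A O : Finset (Fin n)) (hAZ : Disjoint A Z) (hOA : O ⊆ A)
    (habs : ∀ Z' ⊆ Z, ∃ X ⊆ O, Tl k G ((A ∪ Z') \ X))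
    (hw : Z.card + A.card ≤ w)
    (hb : ((univ : Finset (Fin n)).filter (fun v => (nb G v ∩ Z).card < τ)).card ≤ b)
    (h1 : w + b + (k - 2) * a + (k - 1) * b < h)
    (h2 : ∀ l, s < l → n * (l + k * (k * a + k)) + k * l * (k * a) < k * l * (h - w - k * b))
    (h3 : (k - 2) * a + (k - 1) * s < τ) :
    ∃ T, IsTiling (SimpleGraph.cycleGraph k) G T ∧ (univ \ T.biUnion id).card ≤ O.card := by
  classical
  set B0 := (univ : Finset (Fin n)).filter (fun v => (nb G v ∩ Z).card < τ) with hB0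
  set V1 := univ \ (Z ∪ A) with hV1
  have hdeg1 : ∀ (v : Fin n) (R S : Finset (Fin n)) (r : ℕ), (∀ x, x ∉ R → x ∈ S) → R.card ≤ r →
      h - r ≤ (nb G v ∩ S).card := by
    intro v R S r hRS hr
    have e1 := hdeg v
    have e2 := Finset.le_card_sdiff R (nb G v)
    have e3 : (nb G v \ R).card ≤ (nb G v ∩ S).card := by
      apply Finset.card_le_card
      intro x hx
      rw [Finset.mem_sdiff] at hx
      exact Finset.mem_inter.2 ⟨hx.1, hRS x hx.2⟩
    omega
  have hZA := Finset.card_union_le Z A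
  have hBc : (B0 ∩ V1).card ≤ b := (Finset.card_le_card Finset.inter_subset_left).trans hb
  obtain ⟨U1, u1, u2, u3⟩ := greedy hk hI b (V1 \ B0) (B0 ∩ V1) (by
      rw [Finset.disjoint_left]
      intro x hx hx'
      exact (Finset.mem_sdiff.1 hx').2 (Finset.mem_inter.1 hx).1) hBc (by
      intro v _
      have := hdeg1 v (Z ∪ A ∪ B0) (V1 \ B0) (w + b) (by
        intro x hx
        simp only [Finset.mem_union, not_or] at hx
        simp [hV1, hx]) (by have := Finset.card_union_le (Z ∪ A) B0; omega)
      omega)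
  set V2 := V1 \ (B0 ∪ U1) with hV2
  have hk1 : k * b = b + (k - 1) * b := by
    obtain ⟨k', rfl⟩ : ∃ k', k = k' + 1 := ⟨k - 1, by omega⟩
    rw [Nat.add_sub_cancel]; ring
  have hU1 : U1.card ≤ (k - 1) * b := u2.trans (Nat.mul_le_mul_left _ hBc)
  obtain ⟨T2, t1, t2, t3⟩ := max_tiling hk hI V2 (h - w - k * b) s (by
      intro v _
      have := hdeg1 v (Z ∪ A ∪ (B0 ∪ U1)) V2 (w + k * b) (by
        intro x hx
        simp only [Finset.mem_union, not_or] at hx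
        simp [hV2, hV1, hx]) (by
          have := Finset.card_union_le (Z ∪ A) (B0 ∪ U1)
          have := Finset.card_union_le B0 U1
          omega)
      omega) h2
  set T2U := T2.biUnion id with hT2U
  have hT2 : Tl k G T2U := ⟨T2, t1, rfl⟩
  have hT2V : T2U ⊆ V2 := by
    intro x hx
    rw [hT2U, Finset.mem_biUnion] at hx
    obtain ⟨S, hS, hxS⟩ := hx
    exact t2 S hS hxS
  have hV1m : ∀ x, x ∈ V1 ↔ x ∉ Z ∧ x ∉ A := by intro x; simp [hV1]
  have hV2m : ∀ x, x ∈ V2 ↔ (x ∉ Z ∧ x ∉ A) ∧ x ∉ B0 ∧ x ∉ U1 := by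
    intro x; rw [hV2, Finset.mem_sdiff, hV1m]; simp
  obtain ⟨U3, v1, v2, v3⟩ := greedy hk hI s Z (V2 \ T2U) (by
      rw [Finset.disjoint_left]
      intro x hx
      exact ((hV2m x).1 (Finset.mem_sdiff.1 hx).1).1.1) t3 (by
      intro v hv
      have hv2 := ((hV2m v).1 (Finset.mem_sdiff.1 hv).1).2.1
      simp only [hB0, Finset.mem_filter, Finset.mem_univ, true_and, not_lt] at hv2
      omega)
  obtain ⟨X, x1, x2⟩ := habs (Z \ U3) Finset.sdiff_subset
  have hU1m : ∀ x ∈ U1, (x ∉ Z ∧ x ∉ A) ∧ x ∉ B0 := by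
    intro x hx
    have := u1 hx
    rw [Finset.mem_sdiff, hV1m] at this
    exact this
  have hT2m : ∀ x ∈ T2U, (x ∉ Z ∧ x ∉ A) ∧ x ∉ B0 ∧ x ∉ U1 := fun x hx => (hV2m x).1 (hT2V hx)
  have hU3m : ∀ x ∈ U3, x ∈ Z := fun x hx => v1 hx
  have hXA : ∀ x ∈ X, x ∈ A := fun x hx => hOA (x1 hx)
  have hAZm : ∀ x ∈ A, x ∉ Z := fun x hx => Finset.disjoint_left.1 hAZ hx
  have d1 : Disjoint (B0 ∩ V1 ∪ U1) T2U := by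
    rw [Finset.disjoint_left]
    intro x hx hx'
    have := hT2m x hx'
    rw [Finset.mem_union, Finset.mem_inter] at hx
    tauto
  have r1 := tl_union u3 hT2 d1
  have d2 : Disjoint (B0 ∩ V1 ∪ U1 ∪ T2U) (V2 \ T2U ∪ U3) := by
    rw [Finset.disjoint_left]
    intro x hx hx'
    have e1 := hT2m x
    have e2 := hU1m x
    have e3 := hU3m x
    rw [Finset.mem_union, Finset.mem_sdiff, hV2m] at hx'
    rw [Finset.mem_union, Finset.mem_union, Finset.mem_inter, hV1m] at hx
    tauto
  have r2 := tl_union r1 v3 d2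
  have d3 : Disjoint (B0 ∩ V1 ∪ U1 ∪ T2U ∪ (V2 \ T2U ∪ U3)) ((A ∪ Z \ U3) \ X) := by
    rw [Finset.disjoint_left]
    intro x hx hx'
    have e1 := hT2m x
    have e2 := hU1m x
    have e3 := hU3m x
    have e4 := hAZm x
    rw [Finset.mem_sdiff, Finset.mem_union, Finset.mem_sdiff] at hx'
    rw [Finset.mem_union, Finset.mem_union, Finset.mem_union, Finset.mem_inter, hV1m,
      Finset.mem_union, Finset.mem_sdiff, hV2m] at hx
    have hx2 : x ∈ A ∨ (x ∈ Z ∧ x ∉ U3) := hx'.1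
    clear hx'
    rcases hx with ((hx | hx) | hx) | (hx | hx)
    · rcases hx2 with h | h
      · exact hx.2.2 h
      · exact hx.2.1 h.1
    · rcases hx2 with h | h
      · exact (e2 hx).1.2 h
      · exact (e2 hx).1.1 h.1
    · rcases hx2 with h | h
      · exact (e1 hx).1.2 h
      · exact (e1 hx).1.1 h.1
    · rcases hx2 with h | h
      · exact hx.1.1.2 h
      · exact hx.1.1.1 h.1
    · rcases hx2 with h | h
      · exact e4 h (e3 hx)
      · exact h.2 hx
  obtain ⟨T, hT, hTU⟩ := tl_union r2 x2 d3
  refine ⟨T, hT, (Finset.card_le_card ?_).trans (Finset.card_le_card x1)⟩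
  rw [hTU]
  intro x hx
  by_contra hxX
  apply (Finset.mem_sdiff.1 hx).2
  simp only [Finset.mem_union, Finset.mem_sdiff, Finset.mem_inter, hV1m, hV2m]
  by_cases a1 : x ∈ A
  · exact Or.inr ⟨Or.inl a1, hxX⟩
  by_cases a2 : x ∈ U3
  · exact Or.inl (Or.inr (Or.inr a2))
  by_cases a3 : x ∈ Z
  · exact Or.inr ⟨Or.inr ⟨a3, a2⟩, hxX⟩
  by_cases a4 : x ∈ B0
  · exact Or.inl (Or.inl (Or.inl (Or.inl ⟨a4, a3, a1⟩)))
  by_cases a5 : x ∈ U1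
  · exact Or.inl (Or.inl (Or.inl (Or.inr a5)))
  by_cases a6 : x ∈ T2U
  · exact Or.inl (Or.inl (Or.inr a6))
  exact Or.inl (Or.inr (Or.inl ⟨⟨⟨a3, a1⟩, a4, a5⟩, a6⟩))

end RTT
namespace RTT

variable {k n : ℕ} {G : SimpleGraph (Fin n)}

lemma cast_sub_ge (a b : ℕ) : (a : ℝ) - b ≤ ((a - b : ℕ) : ℝ) := by
  have h : a ≤ (a - b) + b := by omega
  have h' : (a : ℝ) ≤ ((a - b : ℕ) : ℝ) + b := by exact_mod_cast h
  linarith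

lemma main_nat (hk : 3 ≤ k) {a : ℕ} (hI : Ind G a) (hn : 0 < n)
    (h C m M K g t P τ j s b L : ℕ) (ρ : ℝ) (hρ : 0 ≤ ρ)
    (hdeg : ∀ v, h ≤ (nb G v).card)
    (hK : K = 3 ^ C * k) (hM : M = m + C * (2 * K + 3))
    (hL : L = k + 1 + 2 ^ (2 * k) * (k * (K + 1)))
    (h1 : n + (C + 1) ^ 2 * (M + (k - 2) * a) < (C + 1) * h)
    (h2 : n ^ 3 * ((k - 2) * a + 1) < g ^ 2) (h3 : 2 * n * a < g)
    (h4 : C * (g + 2 * (M + 4) * n) <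
      (t - m) * (h - ((k - 2) * a + m + C * C * (M + 2))))
    (hP : 0 < P)
    (h5 : ∀ b' g' : ℕ, b' * (h - (C * C * (M + 2) + C * t)) ≤ P * (τ * b' + (n / P + 1) * g') →
      (b' : ℝ) - g' ≤ ρ * b')
    (h6 : j * (n / P + 1) * L + k * (K + 2) + 2 * k ≤ m)
    (hb : ρ ^ j * n ≤ b)
    (h7 : j * (n / P + 1) * L + b + (k - 2) * a + (k - 1) * b < h)
    (h8 : ∀ l, s < l → n * (l + k * (k * a + k)) + k * l * (k * a) <
      k * l * (h - j * (n / P + 1) * L - k * b))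
    (h9 : (k - 2) * a + (k - 1) * s < τ) :
    ∃ T, IsTiling (SimpleGraph.cycleGraph k) G T ∧ (univ \ T.biUnion id).card ≤ C * (k - 1) := by
  classical
  obtain ⟨E, c, D, hDC, hcD, hE, hR, hCy⟩ := structure_lemma hk hI hn h C m M K g t hdeg hK hM h1 h2 h3 h4
  obtain ⟨Z, z1, z2, z3⟩ := reservoir (G := G) P (h - (C * C * (M + 2) + C * t)) τ hP E ρ hρ (by
    intro v
    have := hdeg v
    have := Finset.le_card_sdiff E (nb G v)
    omega) h5 j
  have hZL : Z.card * L ≤ j * (n / P + 1) * L := Nat.mul_le_mul_right _ z2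
  obtain ⟨A, O, a1, -, a3, a4, a5, a6, a7⟩ := absorb_chain hk E c hR hCy Z ∅
    (fun z hz => Finset.disjoint_left.1 z1 hz) (by
      rw [← hL, Finset.card_empty]; omega)
  have hAc : Z.card + A.card ≤ j * (n / P + 1) * L := by
    have e : Z.card * L = Z.card + Z.card * (k + 2 ^ (2 * k) * (k * (K + 1))) := by
      rw [hL]; ring
    omega
  have hOc : O.card ≤ C * (k - 1) := by
    have hsub : O ⊆ D.biUnion (fun i => O.filter (fun x => c x = i)) := by
      intro x hx
      rw [Finset.mem_biUnion]
      exact ⟨c x, hcD x, by simp [hx]⟩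
    refine (Finset.card_le_card hsub).trans (Finset.card_biUnion_le.trans ?_)
    refine (Finset.sum_le_card_nsmul _ _ _ (fun i _ => a6 i)).trans ?_
    rw [smul_eq_mul]
    exact Nat.mul_le_mul_right _ hDC
  obtain ⟨T, hT, hTc⟩ := assemble hk hI h (j * (n / P + 1) * L) b τ s hdeg Z A O a1 a4 a7 hAc
    (by exact_mod_cast z3.trans hb) h7 h8 h9
  exact ⟨T, hT, hTc.trans hOc⟩

set_option maxHeartbeats 4000000 in
lemma main_real (hk : 3 ≤ k) {a : ℕ} (hI : Ind G a) (C K P j L : ℕ)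
    (η δ κ la μ γ ξ α : ℝ)
    (hK : K = 3 ^ C * k) (hL : L = k + 1 + 2 ^ (2 * k) * (k * (K + 1)))
    (hdeg : ∀ v, η * n ≤ (nb G v).card) (ha : (a : ℝ) ≤ α * n)
    (hη : 0 < η) (hη1 : η ≤ 1) (hδ : 0 < δ) (hκ : 0 < κ) (hla : 0 < la) (hμ : 0 < μ) (hγ : 0 < γ)
    (hξ : 0 < ξ) (hα : 0 < α) (hC : 1 ≤ C) (hP : 0 < P)
    (hCδ : ((C : ℝ) + 1) * η = 1 + δ) (hkκ : (k : ℝ) * η = 1 + k * κ)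
    (c1 : 8 * C * la = η) (c2 : 32 * C * γ = la * η) (c3 : 64 * C * μ ≤ la * η)
    (c4 : 8 * ((C : ℝ) + 1) ^ 2 * μ ≤ δ) (c5 : 16 * C * C * μ ≤ η)
    (c6 : 4 * k * (1 - η / 8) ^ j ≤ κ) (c7 : 4 * j * L ≤ μ * P) (c8 : 8 * j * L ≤ κ * P)
    (c9 : 16 * P * k * ξ ≤ η) (d1 : 32 * P * k * α ≤ η) (d2 : 16 * k * α ≤ ξ * κ)
    (d3 : 8 * k * α ≤ κ) (d4 : 2 * k * α ≤ γ ^ 2) (d5 : 4 * α ≤ γ)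
    (d6 : 2 * ((C : ℝ) + 1) ^ 2 * k * α ≤ δ) (d7 : 8 * k * α ≤ η) (d8 : 4 * α ≤ μ) (d9 : α ≤ la)
    (hN : (C : ℝ) * (2 * K + 3) + 4 + k * (K + 2) + 2 * k + P + 2 ≤ α * n) :
    ∃ T, IsTiling (SimpleGraph.cycleGraph k) G T ∧ (univ \ T.biUnion id).card ≤ C * (k - 1) := by
  have hkR : (3 : ℝ) ≤ k := by exact_mod_cast hk
  have hCR : (1 : ℝ) ≤ C := by exact_mod_cast hC
  have hPR : (1 : ℝ) ≤ P := by exact_mod_cast hP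
  have hx1 : (2 : ℝ) ≤ α * n := by
    have : (0 : ℝ) ≤ (C : ℝ) * (2 * K + 3) + 4 + k * (K + 2) + 2 * k + P := by positivity
    linarith
  have hn : 0 < n := by
    rcases Nat.eq_zero_or_pos n with h0 | h0
    · rw [h0] at hx1; norm_num at hx1
    · exact h0
  have hnR : (1 : ℝ) ≤ n := by exact_mod_cast hn
  have hn0 : (0 : ℝ) ≤ n := by linarith
  have hα1 : α ≤ 1 := by
    have : (8 : ℝ) * 3 * α ≤ 8 * k * α := by gcongr
    linarith
  have hPn : (P : ℝ) ≤ n := by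
    have e1 : (0 : ℝ) ≤ (C : ℝ) * (2 * K + 3) + 4 + k * (K + 2) + 2 * k + 2 := by positivity
    have e2 : α * n ≤ 1 * n := by gcongr
    linarith
  obtain ⟨k2, rfl⟩ : ∃ k2, k = k2 + 2 := ⟨k - 2, by omega⟩
  have hk2 : k2 + 2 - 2 = k2 := by omega
  have hk1 : k2 + 2 - 1 = k2 + 1 := by omega
  push_cast at hkR hkκ c6 c9 d1 d2 d3 d4 d6 d7 hN
  have hk20 : (0 : ℝ) ≤ k2 := by positivity
  have ha0 : (0 : ℝ) ≤ a := by positivity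
  -- the parameters
  set h := ⌈η * n⌉₊ with hh
  set m := ⌊μ * n⌋₊ with hm
  set M := m + C * (2 * K + 3) with hM
  set t := ⌈la * n⌉₊ with ht
  set g := ⌈γ * n ^ 2⌉₊ with hg
  set τ := ⌊η * n / (4 * P)⌋₊ with hτ
  set s := ⌊ξ * n⌋₊ with hs
  set b := ⌈(1 - η / 8) ^ j * (n : ℝ)⌉₊ with hb
  have ph : η * n ≤ h := Nat.le_ceil _
  have pm1 : (m : ℝ) ≤ μ * n := Nat.floor_le (by positivity)
  have pm2 : μ * n < m + 1 := Nat.lt_floor_add_one _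
  have pt1 : la * n ≤ t := Nat.le_ceil _
  have pt2 : (t : ℝ) < la * n + 1 := Nat.ceil_lt_add_one (by positivity)
  have pg1 : γ * n ^ 2 ≤ g := Nat.le_ceil _
  have pg2 : (g : ℝ) < γ * n ^ 2 + 1 := Nat.ceil_lt_add_one (by positivity)
  have pτ1 : (τ : ℝ) ≤ η * n / (4 * P) := Nat.floor_le (by positivity)
  have pτ2 : η * n / (4 * P) < τ + 1 := Nat.lt_floor_add_one _
  have ps2 : ξ * n < s + 1 := Nat.lt_floor_add_one _
  have ps1 : (s : ℝ) ≤ ξ * n := Nat.floor_le (by positivity)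
  have pb1 : (1 - η / 8) ^ j * (n : ℝ) ≤ b := Nat.le_ceil _
  have hρ0 : 0 ≤ 1 - η / 8 := by linarith
  have pb2 : (b : ℝ) < (1 - η / 8) ^ j * (n : ℝ) + 1 := Nat.ceil_lt_add_one (by positivity)
  have hαμ : 4 * (α * n) ≤ μ * n := by
    have := mul_le_mul_of_nonneg_right d8 hn0; linarith
  have hαla : α * n ≤ la * n := by gcongr
  have hαγ : 4 * (α * n) ≤ γ * n := by
    have := mul_le_mul_of_nonneg_right d5 hn0; linarith
  have pM : (M : ℝ) + 4 ≤ 2 * (μ * n) := by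
    have e1 : (0 : ℝ) ≤ (k2 + 2) * (K + 2) + 2 * (k2 + 2) + P + 2 := by positivity
    rw [hM]; push_cast
    linarith
  have pM0 : (0 : ℝ) ≤ M := by positivity
  have hγn : 1 ≤ γ * n ^ 2 := by
    have e1 : γ * n * 1 ≤ γ * n * n := by gcongr
    have e2 : γ * n * n = γ * n ^ 2 := by ring
    linarith
  have hka' : (k2 : ℝ) * a ≤ k2 * (α * n) := by gcongr
  have hka : (k2 : ℝ) * a ≤ (k2 + 2) * (α * n) := by linarith
  have hCC : (C : ℝ) * C * (M + 2) ≤ 2 * (C * C * μ * n) := by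
    have : (C : ℝ) * C * (M + 2) ≤ C * C * (2 * (μ * n)) := by
      gcongr; linarith
    linarith
  have hCC2 : 16 * (C * C * μ * n) ≤ η * n := by
    have := mul_le_mul_of_nonneg_right c5 hn0; linarith
  have hμη : 16 * (μ * n) ≤ η * n := by
    have e : 1 * 1 * μ * n ≤ C * C * μ * n := by gcongr
    linarith
  have hkaη : 8 * ((k2 + 2) * (α * n)) ≤ η * n := by
    have := mul_le_mul_of_nonneg_right d7 hn0; linarith
  have hlaη : 8 * (C * (la * n)) = η * n := by rw [← c1]; ring
  have hμla : 2 * (μ * n) ≤ la * n := by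
    have e1 : 64 * 1 * μ ≤ 64 * C * μ := by gcongr
    have e2 : la * η ≤ la * 1 := by gcongr
    have e3 : 2 * μ ≤ la := by linarith
    have := mul_le_mul_of_nonneg_right e3 hn0; linarith
  have hw : (j : ℝ) * ((n / P + 1 : ℕ) : ℝ) * L ≤ 2 * (j * L) / P * n := by
    have e1 : ((n / P : ℕ) : ℝ) ≤ n / P := Nat.cast_div_le
    have e2 : (1 : ℝ) ≤ n / P := by rw [le_div_iff₀ (by linarith)]; linarith
    calc (j : ℝ) * ((n / P + 1 : ℕ) : ℝ) * L ≤ j * (n / P + n / P) * L := by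
          push_cast
          gcongr
      _ = 2 * (j * L) / P * n := by ring
  have hw1 : (j : ℝ) * ((n / P + 1 : ℕ) : ℝ) * L ≤ μ * n / 2 := by
    refine hw.trans ?_
    have : 2 * (j * L) / (P : ℝ) ≤ μ / 2 := by
      rw [div_le_iff₀ (by linarith)]; linarith
    have := mul_le_mul_of_nonneg_right this hn0; linarith
  have hw2 : (j : ℝ) * ((n / P + 1 : ℕ) : ℝ) * L ≤ κ * n / 4 := by
    refine hw.trans ?_
    have : 2 * (j * L) / (P : ℝ) ≤ κ / 4 := by
      rw [div_le_iff₀ (by linarith)]; linarith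
    have := mul_le_mul_of_nonneg_right this hn0; linarith
  have hkα : 8 * ((k2 + 2) * (α * n)) ≤ κ * n := by
    have := mul_le_mul_of_nonneg_right d3 hn0; linarith
  have hkb : (k2 + 2 : ℝ) * b ≤ κ * n / 4 + (k2 + 2) := by
    have e1 : (k2 + 2 : ℝ) * b ≤ (k2 + 2) * ((1 - η / 8) ^ j * (n : ℝ) + 1) := by
      gcongr
    have e2 := mul_le_mul_of_nonneg_right c6 hn0
    linarith
  have hkx : (k2 + 2 : ℝ) ≤ α * n := by
    have e1 : (0 : ℝ) ≤ (C : ℝ) * (2 * K + 3) + 4 + (k2 + 2) * (K + 2) + P + 2 := by positivity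
    linarith
  have hkx2 : (k2 + 2 : ℝ) * (K + 2) + 2 * (k2 + 2) + 2 ≤ α * n := by
    have e1 : (0 : ℝ) ≤ (C : ℝ) * (2 * K + 3) + 4 + P := by positivity
    linarith
  have hκη : κ * n ≤ η * n := by
    have : κ ≤ η := by
      have : ((k2 : ℝ) + 2) * κ ≤ (k2 + 2) * η := by linarith
      exact le_of_mul_le_mul_left this (by linarith)
    gcongr
  refine main_nat hk hI hn h C m M K g t P τ j s b L (1 - η / 8) hρ0 ?_ hK rfl hL ?_ ?_ ?_ ?_ hP
    ?_ ?_ pb1 ?_ ?_ ?_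
  · exact fun v => Nat.ceil_le.2 (hdeg v)
  · rw [hk2]
    have e1 : ((C : ℝ) + 1) ^ 2 * (M + k2 * a) ≤ ((C : ℝ) + 1) ^ 2 * (2 * (μ * n) + (k2 + 2) * (α * n)) := by
      gcongr; linarith
    have e2 := mul_le_mul_of_nonneg_right c4 hn0
    have e3 := mul_le_mul_of_nonneg_right d6 hn0
    have e4 : ((C : ℝ) + 1) * (η * n) ≤ ((C : ℝ) + 1) * h := by gcongr
    have e5 : ((C : ℝ) + 1) * (η * n) = n + δ * n := by rw [← mul_assoc, hCδ]; ring
    have e6 : 0 < δ * n := by positivity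
    have : (n : ℝ) + ((C : ℝ) + 1) ^ 2 * (M + k2 * a) < ((C : ℝ) + 1) * h := by linarith
    exact_mod_cast this
  · rw [hk2]
    have e1 : (k2 : ℝ) * a + 1 ≤ (k2 + 2) * (α * n) := by linarith
    have e2 : (n : ℝ) ^ 3 * (k2 * a + 1) ≤ n ^ 3 * ((k2 + 2) * (α * n)) := by gcongr
    have e3 : (γ * n ^ 2) ^ 2 ≤ (g : ℝ) ^ 2 := by gcongr
    have e4 : (γ * n ^ 2) ^ 2 = γ ^ 2 * (n : ℝ) ^ 4 := by ring
    have e5 : 2 * (k2 + 2) * α * (n : ℝ) ^ 4 ≤ γ ^ 2 * (n : ℝ) ^ 4 := by gcongr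
    have e6 : (n : ℝ) ^ 3 * ((k2 + 2) * (α * n)) = (k2 + 2) * α * (n : ℝ) ^ 4 := by ring
    have e7 : 0 < (k2 + 2) * α * (n : ℝ) ^ 4 := by positivity
    have : (n : ℝ) ^ 3 * (k2 * a + 1) < (g : ℝ) ^ 2 := by linarith
    exact_mod_cast this
  · have e1 : 2 * (n : ℝ) * a ≤ 2 * n * (α * n) := by gcongr
    have e2 : 4 * (α * n) * n ≤ γ * n * n := by gcongr
    have e3 : 0 < α * n * n := by positivity
    have e4 : γ * n * n = γ * n ^ 2 := by ring
    have : 2 * (n : ℝ) * a < g := by linarith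
    exact_mod_cast this
  · rw [hk2]
    have e1 : la * n / 2 ≤ ((t - m : ℕ) : ℝ) := by
      have := cast_sub_ge t m; linarith
    have e2 : η * n / 2 ≤ ((h - (k2 * a + m + C * C * (M + 2)) : ℕ) : ℝ) := by
      have := cast_sub_ge h (k2 * a + m + C * C * (M + 2))
      push_cast at this
      linarith
    have e3 : (la * n / 2) * (η * n / 2) ≤
        ((t - m : ℕ) : ℝ) * ((h - (k2 * a + m + C * C * (M + 2)) : ℕ) : ℝ) := by
      gcongr
    have e4 : (C : ℝ) * (g + 2 * (M + 4) * n) ≤ C * (2 * (γ * n ^ 2) + 2 * (2 * (μ * n)) * n) := by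
      gcongr
      linarith
    have e5 : (C : ℝ) * (2 * (γ * n ^ 2) + 2 * (2 * (μ * n)) * n) =
        (32 * C * γ) * n ^ 2 / 16 + (64 * C * μ) * n ^ 2 / 16 := by ring
    have e6 : (64 * C * μ) * (n : ℝ) ^ 2 ≤ la * η * n ^ 2 := by gcongr
    have e7 : 0 < la * η * (n : ℝ) ^ 2 := by positivity
    have : (C : ℝ) * (g + 2 * (M + 4) * n) <
        ((t - m : ℕ) : ℝ) * ((h - (k2 * a + m + C * C * (M + 2)) : ℕ) : ℝ) := by
      rw [c2] at e5
      linarith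
    exact_mod_cast this
  · intro b' g' hbg
    have e0 : (b' : ℝ) * ((h - (C * C * (M + 2) + C * t) : ℕ) : ℝ) ≤
        P * (τ * b' + ((n / P + 1 : ℕ) : ℝ) * g') := by exact_mod_cast hbg
    have e1 : η * n / 2 ≤ ((h - (C * C * (M + 2) + C * t) : ℕ) : ℝ) := by
      have := cast_sub_ge h (C * C * (M + 2) + C * t)
      push_cast at this
      have q1 : (C : ℝ) * t ≤ C * (2 * (la * n)) := by gcongr; linarith
      linarith
    have e2 : (b' : ℝ) * (η * n / 2) ≤ b' * ((h - (C * C * (M + 2) + C * t) : ℕ) : ℝ) := by gcongr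
    have e3 : (P : ℝ) * τ ≤ η * n / 4 := by
      have : (P : ℝ) * τ ≤ P * (η * n / (4 * P)) := by gcongr
      have e : (P : ℝ) * (η * n / (4 * P)) = η * n / 4 := by field_simp
      linarith
    have e4 : (P : ℝ) * ((n / P + 1 : ℕ) : ℝ) ≤ 2 * n := by
      have q1 : ((n / P : ℕ) : ℝ) ≤ n / P := Nat.cast_div_le
      have q2 : (P : ℝ) * ((n / P : ℕ) : ℝ) ≤ n := by exact_mod_cast Nat.mul_div_le n P
      push_cast
      linarith
    have e5 : (P : ℝ) * τ * b' ≤ η * n / 4 * b' := by gcongr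
    have e6 : (P : ℝ) * ((n / P + 1 : ℕ) : ℝ) * g' ≤ 2 * n * g' := by gcongr
    have e7 : (n : ℝ) * (b' * η / 8) ≤ n * g' := by linarith
    have e8 : (b' : ℝ) * η / 8 ≤ g' := le_of_mul_le_mul_left e7 (by linarith)
    linarith
  · have : (j : ℝ) * ((n / P + 1 : ℕ) : ℝ) * L + (k2 + 2) * (K + 2) + 2 * (k2 + 2) ≤ m := by
      linarith
    exact_mod_cast this
  · rw [hk2, hk1]
    have e : 0 < κ * n := by positivity
    have : (j : ℝ) * ((n / P + 1 : ℕ) : ℝ) * L + b + k2 * a + (k2 + 1) * b < h := by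
      linarith
    exact_mod_cast this
  · intro l hl
    have hl1 : ξ * n ≤ l := by
      have : (s : ℝ) + 1 ≤ l := by exact_mod_cast hl
      linarith
    have hl0 : (0 : ℝ) < l := lt_of_lt_of_le (by positivity) hl1
    have e1 : (η - κ * (5 / 8)) * n ≤ ((h - j * (n / P + 1) * L - (k2 + 2) * b : ℕ) : ℝ) := by
      have q1 := cast_sub_ge h (j * (n / P + 1) * L)
      have q2 := cast_sub_ge (h - j * (n / P + 1) * L) ((k2 + 2) * b)
      rw [Nat.cast_mul, Nat.cast_mul] at q1
      rw [Nat.cast_mul (k2 + 2) b] at q2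
      push_cast at q2
      have q3 : (k2 + 2 : ℝ) ≤ κ * n / 8 := by
        have : 1 * (α * n) ≤ (k2 + 2) * (α * n) := by
          apply mul_le_mul_of_nonneg_right _ (by positivity)
          linarith
        linarith
      linarith
    have e2 : (k2 + 2 : ℝ) * l * ((η - κ * (5 / 8)) * n) ≤
        (k2 + 2) * l * ((h - j * (n / P + 1) * L - (k2 + 2) * b : ℕ) : ℝ) := by gcongr
    have e3 : (k2 + 2 : ℝ) * l * ((η - κ * (5 / 8)) * n) =
        l * n + (3 / 8) * ((k2 + 2) * κ * l * n) := by
      have : (k2 + 2 : ℝ) * l * ((η - κ * (5 / 8)) * n) =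
        ((k2 + 2 : ℝ) * η) * l * n - (5 / 8) * ((k2 + 2) * κ * l * n) := by ring
      rw [this, hkκ]; ring
    have e4 : (k2 + 2 : ℝ) * l * ((k2 + 2) * a) ≤ (k2 + 2) * l * ((k2 + 2) * (α * n)) := by gcongr
    have e5 : (k2 + 2 : ℝ) * l * ((k2 + 2) * (α * n)) ≤ (k2 + 2 : ℝ) * l * (κ * n / 8) := by
      gcongr; linarith
    have e6 : (n : ℝ) * ((k2 + 2) * ((k2 + 2) * a + (k2 + 2))) ≤
        n * ((k2 + 2) * ((k2 + 2) * (2 * (α * n)))) := by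
      have : (k2 + 2 : ℝ) * a + (k2 + 2) ≤ (k2 + 2) * (2 * (α * n)) := by
        have q1 : (k2 + 2 : ℝ) * a ≤ (k2 + 2) * (α * n) := by gcongr
        have q2 : (k2 + 2 : ℝ) * 1 ≤ (k2 + 2) * (α * n) := by gcongr; linarith
        linarith
      gcongr
    have e7 : (n : ℝ) * ((k2 + 2) * ((k2 + 2) * (2 * (α * n)))) =
        (16 * (k2 + 2) * α) * (n * ((k2 + 2) * n)) / 8 := by ring
    have e8 : (16 * (k2 + 2) * α) * (n * ((k2 + 2) * n)) ≤ ξ * κ * (n * ((k2 + 2) * n)) := by gcongr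
    have e9 : ξ * κ * (n * ((k2 + 2) * n)) = κ * (n * (k2 + 2)) * (ξ * n) := by ring
    have e10 : κ * (n * (k2 + 2)) * (ξ * n) ≤ κ * (n * (k2 + 2)) * l := by gcongr
    have e11 : 0 < κ * (n * (k2 + 2)) * l := by positivity
    have : (n : ℝ) * (l + (k2 + 2) * ((k2 + 2) * a + (k2 + 2))) + (k2 + 2) * l * ((k2 + 2) * a) <
        (k2 + 2) * l * ((h - j * (n / P + 1) * L - (k2 + 2) * b : ℕ) : ℝ) := by
      linarith
    exact_mod_cast this
  · rw [hk2, hk1]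
    have e1 : (k2 + 2) * (α * n) ≤ η * n / (4 * P) / 8 := by
      rw [div_div, le_div_iff₀ (by positivity)]
      have := mul_le_mul_of_nonneg_right d1 hn0
      linarith
    have e2 : (k2 + 2) * (ξ * n) ≤ η * n / (4 * P) / 4 := by
      rw [div_div, le_div_iff₀ (by positivity)]
      have := mul_le_mul_of_nonneg_right c9 hn0
      linarith
    have e3 : (k2 + 1 : ℝ) * s ≤ (k2 + 2) * (ξ * n) := by
      gcongr; norm_num
    have e4 : 1 ≤ η * n / (4 * P) / 8 := by
      have q2 : (2 : ℝ) * 1 ≤ (k2 + 2) * (α * n) := by gcongr <;> linarith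
      linarith
    have : (k2 : ℝ) * a + (k2 + 1) * s < τ := by linarith
    exact_mod_cast this

end RTT
namespace RTT

lemma min_pos6 (l : List ℝ) (h : ∀ x ∈ l, 0 < x) :
    ∃ y : ℝ, 0 < y ∧ ∀ x ∈ l, y ≤ x := by
  induction l with
  | nil => exact ⟨1, one_pos, by simp⟩
  | cons z l ih =>
    obtain ⟨y, hy, hyl⟩ := ih (fun x hx => h x (List.mem_cons_of_mem _ hx))
    refine ⟨min z y, lt_min (h z List.mem_cons_self) hy, ?_⟩
    intro x hx
    rcases List.mem_cons.1 hx with rfl | hx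
    · exact min_le_left _ _
    · exact (min_le_right _ _).trans (hyl x hx)

end RTT

open RTT in
/-- For every integer `k ≥ 3` and constant `1/k < η ≤ 1` there exists `α > 0`
such that for all sufficiently large `n`, every `n`-vertex graph `G` with `δ(G) ≥ ηn` and
`α(G) ≤ αn` contains a `C_k`-tiling covering all but at most `⌊1/η⌋(k-1)` vertices. -/
theorem quasiperfect_cycle_tiling :
    ∀ k : ℕ, 3 ≤ k → ∀ η : ℝ, 1 / (k : ℝ) < η → η ≤ 1 →
    ∃ α : ℝ, 0 < α ∧ ∃ N : ℕ, ∀ n : ℕ, N ≤ n →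
      ∀ G : SimpleGraph (Fin n),
        MinDegGE G (η * n) → IndepBound G 2 (α * n) →
        ∃ T : Finset (Finset (Fin n)),
          IsTiling (SimpleGraph.cycleGraph k) G T ∧
          (Finset.univ \ T.biUnion id).card ≤ ⌊1 / η⌋₊ * (k - 1) := by
  intro k hk η hη hη1
  have hkR : (3 : ℝ) ≤ k := by exact_mod_cast hk
  have hk0 : (0 : ℝ) < k := by linarith
  have hη0 : 0 < η := lt_trans (by positivity) hη
  set C := ⌊1 / η⌋₊ with hC
  have hC1 : 1 ≤ C := Nat.le_floor (by rw [Nat.cast_one, le_div_iff₀ hη0]; linarith)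
  have hCR : (1 : ℝ) ≤ C := by exact_mod_cast hC1
  have hC0 : (0 : ℝ) < C := by linarith
  have hδ : 0 < ((C : ℝ) + 1) * η - 1 := by
    have h := Nat.lt_floor_add_one (1 / η)
    rw [div_lt_iff₀ hη0] at h
    linarith
  set δ := ((C : ℝ) + 1) * η - 1 with hδd
  have hκ : 0 < η - 1 / k := by linarith
  set κ := η - 1 / (k : ℝ) with hκd
  have hkκ : (k : ℝ) * η = 1 + k * κ := by rw [hκd]; field_simp; ring
  obtain ⟨K, hK⟩ : ∃ K, K = 3 ^ C * k := ⟨_, rfl⟩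
  obtain ⟨L, hL⟩ : ∃ L, L = k + 1 + 2 ^ (2 * k) * (k * (K + 1)) := ⟨_, rfl⟩
  set la := η / (8 * C) with hla
  have hla0 : 0 < la := by positivity
  set γ := la * η / (32 * C) with hγ
  have hγ0 : 0 < γ := by positivity
  obtain ⟨μ, hμ0, hμ⟩ := min_pos6
    [la * η / (64 * C), δ / (8 * ((C : ℝ) + 1) ^ 2), η / (16 * C * C)] (by
      simp only [List.mem_cons, List.not_mem_nil, or_false, forall_eq_or_imp, forall_eq]
      refine ⟨by positivity, by positivity, by positivity⟩)
  simp only [List.mem_cons, List.not_mem_nil, or_false, forall_eq_or_imp, forall_eq] at hμ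
  obtain ⟨m1, m2, m3⟩ := hμ
  obtain ⟨j, hj⟩ : ∃ j : ℕ, (1 - η / 8) ^ j < κ / (4 * k) :=
    exists_pow_lt_of_lt_one (by positivity) (by linarith)
  obtain ⟨P, hP⟩ : ∃ P : ℕ, max (max (4 * j * L / μ) (8 * j * L / κ)) 0 < P := exists_nat_gt _
  rw [max_lt_iff, max_lt_iff] at hP
  obtain ⟨⟨p1, p2⟩, p3⟩ := hP
  have hP0 : 0 < P := by exact_mod_cast p3
  set ξ := η / (16 * P * k) with hξ
  have hξ0 : 0 < ξ := by positivity
  obtain ⟨α, hα0, hα⟩ := min_pos6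
    [η / (32 * P * k), ξ * κ / (16 * k), κ / (8 * k), γ ^ 2 / (2 * k), γ / 4,
      δ / (2 * ((C : ℝ) + 1) ^ 2 * k), η / (8 * k), μ / 4, la] (by
      simp only [List.mem_cons, List.not_mem_nil, or_false, forall_eq_or_imp, forall_eq]
      refine ⟨by positivity, by positivity, by positivity, by positivity, by positivity,
        by positivity, by positivity, by positivity, by positivity⟩)
  simp only [List.mem_cons, List.not_mem_nil, or_false, forall_eq_or_imp, forall_eq] at hα
  obtain ⟨a1, a2, a3, a4, a5, a6, a7, a8, a9⟩ := hα
  obtain ⟨N, hN⟩ := exists_nat_gt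
    (((C : ℝ) * (2 * K + 3) + 4 + k * (K + 2) + 2 * k + P + 2) / α)
  refine ⟨α, hα0, N, ?_⟩
  intro n hn G hdeg hind
  have hnN : (N : ℝ) ≤ n := by exact_mod_cast hn
  have hI : Ind G ⌊α * n⌋₊ := by
    intro S hS
    apply Nat.le_floor
    apply hind S
    intro T hT hcl
    rw [SimpleGraph.isNClique_iff] at hcl
    obtain ⟨x, y, hxy, rfl⟩ := Finset.card_eq_two.1 hcl.2
    exact hS x (hT (by simp)) y (hT (by simp)) (hcl.1 (by simp) (by simp) hxy)
  refine main_real hk hI C K P j L η δ κ la μ γ ξ α hK hL ?_ (Nat.floor_le (by positivity))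
    hη0 hη1 hδ hκ hla0 hμ0 hγ0 hξ0 hα0 hC1 hP0 (by rw [hδd]; ring) hkκ ?_ ?_ ?_ ?_ ?_ ?_ ?_ ?_ ?_
    ?_ ?_ ?_ ?_ ?_ ?_ ?_ ?_ a9 ?_
  · intro v
    have h := hdeg v
    have e : (G.neighborSet v).ncard = (nb G v).card := by
      rw [← Set.ncard_coe_finset]
      congr 1
      ext w
      simp [mem_nb]
    rwa [e] at h
  · rw [hla]; field_simp
  · rw [hγ]; field_simp
  · rw [le_div_iff₀ (by positivity)] at m1; linarith
  · rw [le_div_iff₀ (by positivity)] at m2; linarith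
  · rw [le_div_iff₀ (by positivity)] at m3; linarith
  · rw [lt_div_iff₀ (by positivity)] at hj; linarith
  · rw [div_lt_iff₀ hμ0] at p1; linarith
  · rw [div_lt_iff₀ hκ] at p2; linarith
  · rw [hξ]; apply le_of_eq; field_simp
  · rw [le_div_iff₀ (by positivity)] at a1; linarith
  · rw [le_div_iff₀ (by positivity)] at a2; linarith
  · rw [le_div_iff₀ (by positivity)] at a3; linarith
  · rw [le_div_iff₀ (by positivity)] at a4; linarith
  · linarith
  · rw [le_div_iff₀ (by positivity)] at a6; linarith
  · rw [le_div_iff₀ (by positivity)] at a7; linarith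
  · linarith
  · rw [div_lt_iff₀ hα0] at hN
    have : (N : ℝ) * α ≤ n * α := by gcongr
    linarith
end

section
/- For every integer k ≥ 3, every tree T on k vertices and every constant η > 0 there exists α > 0 such that the following holds for all sufficiently large n ∈ ℕ divisible by k: every n-vertex graph G with minimum degree δ(G) ≥ ηn and α*(G) ≤ αn contains a perfect T-tiling (a T-factor covering every vertex of G). -/
open Finset

namespace RTT

lemma hall_aux {m t : ℕ} (R : Fin m → Fin m → Prop)
    (h1 : ∀ b, ∃ Z : Finset (Fin m), t + 1 ≤ Z.card ∧ ∀ c ∈ Z, R b c)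
    (h2 : ∀ c, ∃ Z : Finset (Fin m), t + 1 ≤ Z.card ∧ ∀ b ∈ Z, R b c)
    (h3 : ∀ X Y : Finset (Fin m), X.card = t + 1 → Y.card = t + 1 →
      ∃ x ∈ X, ∃ y ∈ Y, R x y) :
    ∃ f : Fin m → Fin m, Function.Injective f ∧ ∀ b, R b (f b) := by
  classical
  have key := (Finset.all_card_le_biUnion_card_iff_exists_injective
    (fun b : Fin m => Finset.univ.filter (fun c => R b c))).1
  obtain ⟨f, hf, hf2⟩ := key (by
    intro X
    set N := X.biUnion (fun b => Finset.univ.filter (fun c => R b c)) with hN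
    have hmem : ∀ b ∈ X, ∀ c, R b c → c ∈ N := by
      intro b hb c hc
      simp only [hN, Finset.mem_biUnion, Finset.mem_filter, Finset.mem_univ, true_and]
      exact ⟨b, hb, hc⟩
    by_contra hlt
    push Not at hlt
    have hXne : X.Nonempty := by
      rw [← Finset.card_pos]; omega
    obtain ⟨b, hb⟩ := hXne
    obtain ⟨Z, hZ, hZR⟩ := h1 b
    have hZN : Z.card ≤ N.card := Finset.card_le_card (fun c hc => hmem b hb c (hZR c hc))
    obtain ⟨X', hX', hX'c⟩ := Finset.exists_subset_card_eq (s := X) (n := t + 1) (by omega)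
    have hcN : Nᶜ.card = m - N.card := by simp [Finset.card_compl]
    have hXm : X.card ≤ m := by simpa using Finset.card_le_univ X
    have hne : Nᶜ.Nonempty := by rw [← Finset.card_pos]; omega
    obtain ⟨c, hc⟩ := hne
    obtain ⟨W, hW, hWR⟩ := h2 c
    have hWX : W ⊆ Xᶜ := by
      intro b' hb'
      rw [Finset.mem_compl]
      intro hb''
      exact (Finset.mem_compl.1 hc) (hmem b' hb'' c (hWR b' hb'))
    have hWc := Finset.card_le_card hWX
    have hcX : Xᶜ.card = m - X.card := by simp [Finset.card_compl]
    obtain ⟨Y, hY, hYc⟩ := Finset.exists_subset_card_eq (s := Nᶜ) (n := t + 1) (by omega)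
    obtain ⟨x, hx, y, hy, hxy⟩ := h3 X' Y hX'c hYc
    exact (Finset.mem_compl.1 (hY hy)) (hmem x (hX' hx) y hxy))
  exact ⟨f, hf, fun b => by simpa using hf2 b⟩

lemma shift_aux {m k t L : ℕ} (hk : 0 < k) {I : Type*} [Fintype I]
    (B : I → Finset (Fin m)) (c : I → Fin m → Fin k) (hL : ∀ i, L ≤ (B i).card)
    (h : (Fintype.card I : ℝ) * (1 - 1 / (2 * k)) ^ L * 2 ^ t < 1) :
    ∃ s : Fin m → Fin k, ∀ i, t + 1 ≤ ((B i).filter (fun b => s b = c i b)).card := by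
  classical
  by_contra hcon
  push Not at hcon
  have hk0 : (0 : ℝ) < k := by exact_mod_cast hk
  have hk1 : (1 : ℝ) ≤ k := by exact_mod_cast hk
  set q : ℝ := 1 - 1 / (2 * k) with hq
  have hq0 : 0 ≤ q := by
    rw [hq, sub_nonneg, div_le_one (by positivity)]; linarith
  have hq1 : q ≤ 1 := by
    rw [hq]; have : (0 : ℝ) ≤ 1 / (2 * k) := by positivity
    linarith
  let w : I → (Fin m → Fin k) → ℝ := fun i s =>
    ∏ b, (if b ∈ B i ∧ s b = c i b then (1 / 2 : ℝ) else 1)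
  have hw : ∀ i s, w i s = (1 / 2 : ℝ) ^ ((B i).filter (fun b => s b = c i b)).card := by
    intro i s
    simp only [w]
    rw [Finset.prod_ite]
    simp only [Finset.prod_const, one_pow, mul_one]
    congr 2
    ext b; simp
  have hw0 : ∀ i s, 0 ≤ w i s := by intro i s; rw [hw]; positivity
  have hsum : ∀ i, ∑ s, w i s = (k : ℝ) ^ m * q ^ (B i).card := by
    intro i
    have h1 := Finset.prod_univ_sum (fun _ : Fin m => (Finset.univ : Finset (Fin k)))
      (fun b j => if b ∈ B i ∧ j = c i b then (1 / 2 : ℝ) else 1)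
    rw [Fintype.piFinset_univ] at h1
    simp only [w]
    rw [← h1]
    have h2 : ∀ b : Fin m, ∑ j : Fin k, (if b ∈ B i ∧ j = c i b then (1 / 2 : ℝ) else 1)
        = k * (if b ∈ B i then q else 1) := by
      intro b
      by_cases hb : b ∈ B i
      · have : ∀ j : Fin k, (if b ∈ B i ∧ j = c i b then (1 / 2 : ℝ) else 1)
            = 1 - (if j = c i b then 1 / 2 else 0) := by
          intro j; by_cases hj : j = c i b <;> simp [hb, hj]; norm_num
        rw [Finset.sum_congr rfl (fun j _ => this j)]
        simp only [Finset.sum_sub_distrib, Finset.sum_ite_eq', hb, if_true,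
          Finset.mem_univ, Finset.sum_const, Finset.card_univ, Fintype.card_fin, nsmul_eq_mul]
        rw [hq]; field_simp
      · simp [hb]
    rw [Finset.prod_congr rfl (fun b _ => h2 b), Finset.prod_mul_distrib, Finset.prod_ite]
    simp
  have hbig : ∀ s : Fin m → Fin k, (1 / 2 : ℝ) ^ t ≤ ∑ i, w i s := by
    intro s
    obtain ⟨i, hi⟩ := hcon s
    calc (1 / 2 : ℝ) ^ t ≤ w i s := by
          rw [hw]; exact pow_le_pow_of_le_one (by norm_num) (by norm_num) (by omega)
      _ ≤ _ := Finset.single_le_sum (f := fun i => w i s) (fun i _ => hw0 i s) (Finset.mem_univ i)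
  have hA : (k : ℝ) ^ m * (1 / 2) ^ t ≤ ∑ s, ∑ i, w i s := by
    have := Finset.card_nsmul_le_sum (Finset.univ : Finset (Fin m → Fin k))
      (fun s => ∑ i, w i s) ((1 / 2 : ℝ) ^ t) (fun s _ => hbig s)
    simpa using this
  have hB : ∑ s, ∑ i, w i s ≤ (k : ℝ) ^ m * ((Fintype.card I : ℝ) * q ^ L) := by
    rw [Finset.sum_comm]
    calc ∑ i, ∑ s, w i s ≤ ∑ _i : I, (k : ℝ) ^ m * q ^ L := by
          apply Finset.sum_le_sum
          intro i _
          rw [hsum]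
          exact mul_le_mul_of_nonneg_left (pow_le_pow_of_le_one hq0 hq1 (hL i)) (by positivity)
      _ = _ := by simp; ring
  have hC : (1 / 2 : ℝ) ^ t ≤ (Fintype.card I : ℝ) * q ^ L :=
    le_of_mul_le_mul_left (hA.trans hB) (by positivity)
  have hD : (1 / 2 : ℝ) ^ t * 2 ^ t = 1 := by rw [← mul_pow]; norm_num
  have : (1 : ℝ) ≤ (Fintype.card I : ℝ) * q ^ L * 2 ^ t := by
    rw [← hD]; exact mul_le_mul_of_nonneg_right hC (by positivity)
  linarith

/-- Composition of maps along a walk. -/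
def wfold {V X : Type*} {F : SimpleGraph V} (π : V → V → X → X) {r : V} :
    ∀ {a : V}, F.Walk a r → X → X
  | _, .nil => id
  | a, .cons (v := b) _ w => fun x => π b a (wfold π w x)

lemma wfold_inj {V X : Type*} {F : SimpleGraph V} (π : V → V → X → X)
    (hπ : ∀ a b, Function.Injective (π a b)) {r : V} :
    ∀ {a : V} (w : F.Walk a r), Function.Injective (wfold π w)
  | _, .nil => fun _ _ h => h
  | a, .cons (v := b) _ w => fun x y h => wfold_inj π hπ w (hπ b a h)

lemma tree_path {V : Type*} {F : SimpleGraph V} (hF : F.IsTree) (r : V)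
    (P : ∀ a, F.Walk a r) (hP : ∀ a, (P a).IsPath) (a b : V) (h : F.Adj a b) :
    P a = .cons h (P b) ∨ P b = .cons h.symm (P a) := by
  classical
  have huniq : ∀ {u v : V} (p q : F.Walk u v), p.IsPath → q.IsPath → p = q := by
    intro u v p q hp hq
    exact congrArg Subtype.val (hF.isAcyclic.path_unique ⟨p, hp⟩ ⟨q, hq⟩)
  by_cases ha : a ∈ (P b).support
  · right
    have h1 : (P b).takeUntil a ha = .cons h.symm .nil :=
      huniq _ _ ((hP b).takeUntil ha) (by simp [h.ne'])
    have h2 : (P b).dropUntil a ha = P a := huniq _ _ ((hP b).dropUntil ha) (hP a)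
    have h3 := (P b).take_spec ha
    rw [h1, h2] at h3
    rw [← h3]; rfl
  · left
    exact huniq _ _ (hP a) ((hP b).cons ha)

lemma tree_aux {V X : Type*} {F : SimpleGraph V} (hF : F.IsTree)
    (R : V → V → X → X → Prop) (hR : ∀ a b x y, R a b x y → R b a y x)
    (π : V → V → X → X) (hπ : ∀ a b, Function.Injective (π a b))
    (hπR : ∀ a b, F.Adj a b → ∀ x, R a b x (π a b x)) :
    ∃ g : V → X → X, (∀ a, Function.Injective (g a)) ∧
      ∀ a b, F.Adj a b → ∀ x, R a b (g a x) (g b x) := by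
  classical
  obtain ⟨r⟩ := hF.connected.nonempty
  have hex : ∀ a, ∃ p : F.Walk a r, p.IsPath := fun a => (hF.existsUnique_path a r).exists
  choose P hP using hex
  refine ⟨fun a => wfold π (P a), fun a => wfold_inj π hπ _, ?_⟩
  intro a b h x
  rcases tree_path hF r P hP a b h with h1 | h1
  · apply hR
    show R b a (wfold π (P b) x) (wfold π (P a) x)
    rw [h1]
    exact hπR b a h.symm _
  · show R a b (wfold π (P a) x) (wfold π (P b) x)
    rw [h1]
    exact hπR a b h _

lemma asym_aux (k : ℕ) (hk : 0 < k) (η : ℝ) (hη : 0 < η) :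
    ∃ α : ℝ, 0 < α ∧ ∃ M : ℕ, ∀ m : ℕ, M ≤ m →
      ((m * k * k : ℕ) : ℝ) * (1 - 1 / (2 * k)) ^ ⌈η * m⌉₊ * 2 ^ ⌊α * ((m * k : ℕ) : ℝ)⌋₊ < 1 := by
  have hk1 : (1 : ℝ) ≤ k := by exact_mod_cast hk
  set q : ℝ := 1 - 1 / (2 * k) with hq
  have hq0 : 0 < q := by
    rw [hq, sub_pos, div_lt_one (by positivity)]; linarith
  have hq1 : q < 1 := by
    rw [hq]; have : (0 : ℝ) < 1 / (2 * k) := by positivity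
    linarith
  have hlq : Real.log q < 0 := Real.log_neg hq0 hq1
  have hl2 : 0 < Real.log 2 := Real.log_pos (by norm_num)
  refine ⟨η * (-Real.log q) / (2 * k * Real.log 2), by
    apply div_pos (mul_pos hη (by linarith)) (by positivity), ?_⟩
  set α := η * (-Real.log q) / (2 * k * Real.log 2) with hα
  have hα0 : 0 < α := div_pos (mul_pos hη (by linarith)) (by positivity)
  have hαe : α * k * Real.log 2 = - (η * Real.log q) / 2 := by
    rw [hα]; field_simp
  set ρ := Real.exp (η * Real.log q / 2) with hρ
  have hρ1 : ρ < 1 := by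
    rw [hρ, Real.exp_lt_one_iff]; nlinarith
  have hρ0 : 0 < ρ := Real.exp_pos _
  have ht := (tendsto_self_mul_const_pow_of_lt_one hρ0.le hρ1).const_mul ((k : ℝ) * k)
  rw [mul_zero] at ht
  obtain ⟨M, hM⟩ := Filter.eventually_atTop.1 (ht.eventually (gt_mem_nhds (zero_lt_one)))
  refine ⟨M, fun m hm => ?_⟩
  have h1 := hM m hm
  have e1 : q ^ ⌈η * m⌉₊ ≤ Real.exp (η * m * Real.log q) := by
    rw [← Real.rpow_natCast, Real.rpow_def_of_pos hq0]
    apply Real.exp_le_exp.2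
    have := Nat.le_ceil (η * m)
    nlinarith
  have e2 : (2 : ℝ) ^ ⌊α * ((m * k : ℕ) : ℝ)⌋₊ ≤ Real.exp (α * (m * k) * Real.log 2) := by
    rw [← Real.rpow_natCast, Real.rpow_def_of_pos (by norm_num)]
    apply Real.exp_le_exp.2
    have := Nat.floor_le (a := α * ((m * k : ℕ) : ℝ)) (by positivity)
    push_cast at this ⊢
    nlinarith
  have e3 : Real.exp (η * m * Real.log q) * Real.exp (α * (m * k) * Real.log 2) = ρ ^ m := by
    rw [← Real.exp_add, hρ, ← Real.exp_nat_mul]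
    congr 1
    have : α * (m * k) * Real.log 2 = m * (α * k * Real.log 2) := by ring
    rw [this, hαe]; ring
  calc ((m * k * k : ℕ) : ℝ) * q ^ ⌈η * m⌉₊ * 2 ^ ⌊α * ((m * k : ℕ) : ℝ)⌋₊
      ≤ ((m * k * k : ℕ) : ℝ) * (Real.exp (η * m * Real.log q)
          * Real.exp (α * (m * k) * Real.log 2)) := by
        rw [mul_assoc]
        gcongr
    _ = k * k * (m * ρ ^ m) := by rw [e3]; push_cast; ring
    _ < 1 := h1

end RTT

open RTT in
/-- For every `k ≥ 3`, every tree `T` on `k` vertices and every `η > 0` there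
exists `α > 0` such that for all sufficiently large `n` divisible by `k`, every `n`-vertex
graph `G` with `δ(G) ≥ ηn` and `α*(G) ≤ αn` contains a perfect `T`-tiling. -/
theorem perfect_tree_tiling_bipartite_holes :
    ∀ k : ℕ, 3 ≤ k → ∀ Tr : SimpleGraph (Fin k), Tr.IsTree →
    ∀ η : ℝ, 0 < η →
    ∃ α : ℝ, 0 < α ∧ ∃ N : ℕ, ∀ n : ℕ, N ≤ n → k ∣ n →
      ∀ G : SimpleGraph (Fin n),
        MinDegGE G (η * n) → HoleBound G (α * n) →
        PerfTilingOn Tr G Finset.univ := by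
  classical
  intro k hk Tr hTr η hη
  obtain ⟨α, hα, M, hM⟩ := asym_aux k (by omega) η hη
  refine ⟨α, hα, k * M, ?_⟩
  rintro n hn ⟨m, rfl⟩ G hdeg hhole
  haveI : NeZero k := ⟨by omega⟩
  have hmM : M ≤ m := Nat.le_of_mul_le_mul_left hn (by omega)
  have hM' := hM m hmM
  set t := ⌊α * ((m * k : ℕ) : ℝ)⌋₊ with ht
  have htlt : α * ((k * m : ℕ) : ℝ) < ((t + 1 : ℕ) : ℝ) := by
    rw [mul_comm k m]; push_cast; simpa [ht] using Nat.lt_floor_add_one (α * ((m * k : ℕ) : ℝ))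
  let e : Fin (k * m) ≃ Fin m × Fin k := (finProdFinEquiv (m := k) (n := m)).symm.trans
    (Equiv.prodComm _ _)
  let Nb : Fin (k * m) → Finset (Fin (k * m)) := fun v => Finset.univ.filter (fun u => G.Adj v u)
  have hNb : ∀ v, η * ((k * m : ℕ) : ℝ) ≤ ((Nb v).card : ℝ) := by
    intro v
    have h1 := hdeg v
    have h2 : G.neighborSet v = (Nb v : Set (Fin (k * m))) := by ext u; simp [Nb]
    rwa [h2, Set.ncard_coe_finset] at h1
  let Bl : Fin (k * m) → Finset (Fin m) := fun v => (Nb v).image (fun u => (e u).1)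
  have hBl : ∀ v, ⌈η * (m : ℝ)⌉₊ ≤ (Bl v).card := by
    intro v
    have h1 : (Nb v).card ≤ (Bl v).card * k := by
      have hinj : (Nb v).card ≤ (Bl v ×ˢ (Finset.univ : Finset (Fin k))).card := by
        apply Finset.card_le_card_of_injOn e
        · intro u hu
          simp only [Finset.coe_product, Set.mem_prod, Finset.mem_coe]
          exact ⟨Finset.mem_image_of_mem _ hu, Finset.mem_univ _⟩
        · exact e.injective.injOn
      simpa using hinj
    have h2 := hNb v
    have h3 : ((Nb v).card : ℝ) ≤ (Bl v).card * k := by exact_mod_cast h1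
    have hk0 : (0 : ℝ) < k := by exact_mod_cast (by omega : 0 < k)
    apply Nat.ceil_le.2
    push_cast at h2
    nlinarith
  have hj : ∀ v b, ∃ j : Fin k, b ∈ Bl v → G.Adj v (e.symm (b, j)) := by
    intro v b
    by_cases hb : b ∈ Bl v
    · obtain ⟨u, hu, rfl⟩ := Finset.mem_image.1 hb
      refine ⟨(e u).2, fun _ => ?_⟩
      simpa [Nb] using hu
    · exact ⟨0, fun h => absurd h hb⟩
  choose J hJ using hj
  obtain ⟨s, hs⟩ := shift_aux (m := m) (k := k) (t := t) (L := ⌈η * (m : ℝ)⌉₊) (by omega)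
    (I := Fin (k * m) × Fin k) (fun i => Bl i.1) (fun i b => i.2 - J i.1 b)
    (fun i => hBl i.1) (by
      have : Fintype.card (Fin (k * m) × Fin k) = m * k * k := by simp [mul_comm k m]
      rw [this]; exact hM')
  let p : Fin k → Fin m → Fin (k * m) := fun i b => e.symm (b, i - s b)
  have hp : ∀ i i' b b', p i b = p i' b' → i = i' ∧ b = b' := by
    intro i i' b b' h
    have h1 := e.symm.injective h
    simp only [Prod.mk.injEq] at h1
    obtain ⟨rfl, h2⟩ := h1
    exact ⟨sub_left_injective h2, rfl⟩
  have hps : ∀ v, ∃ i b, p i b = v := by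
    intro v
    refine ⟨(e v).2 + s (e v).1, (e v).1, ?_⟩
    simp [p]
  have hd : ∀ v i, ∃ Z : Finset (Fin m), t + 1 ≤ Z.card ∧ ∀ c ∈ Z, G.Adj v (p i c) := by
    intro v i
    refine ⟨_, hs (v, i), ?_⟩
    intro b hb
    obtain ⟨hb1, hb2⟩ := Finset.mem_filter.1 hb
    have h3 := hJ v b hb1
    simp only at hb2
    simpa [p, hb2] using h3
  have hmatch : ∀ a b : Fin k, ∃ f : Fin m → Fin m, Function.Injective f ∧
      (a ≠ b → ∀ x, G.Adj (p a x) (p b (f x))) := by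
    intro a b
    by_cases hab : a = b
    · exact ⟨id, Function.injective_id, fun h => absurd hab h⟩
    · obtain ⟨f, hf, hf2⟩ := hall_aux (t := t) (fun x y => G.Adj (p a x) (p b y))
        (fun x => hd (p a x) b)
        (fun y => by
          obtain ⟨Z, hZ, hZ2⟩ := hd (p b y) a
          exact ⟨Z, hZ, fun c hc => (hZ2 c hc).symm⟩)
        (by
          intro X Y hX hY
          by_contra hcon
          push Not at hcon
          have hia : Function.Injective (p a) := fun x y h => (hp _ _ _ _ h).2
          have hib : Function.Injective (p b) := fun x y h => (hp _ _ _ _ h).2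
          have := hhole (t + 1) (X.image (p a)) (Y.image (p b)) (by
              rw [Finset.disjoint_left]
              intro v hv hv'
              obtain ⟨x, _, rfl⟩ := Finset.mem_image.1 hv
              obtain ⟨y, _, hy⟩ := Finset.mem_image.1 hv'
              exact hab (hp _ _ _ _ hy).1.symm)
            (by rw [Finset.card_image_of_injective _ hia, hX])
            (by rw [Finset.card_image_of_injective _ hib, hY])
            (by
              intro u hu v hv
              obtain ⟨x, hx, rfl⟩ := Finset.mem_image.1 hu
              obtain ⟨y, hy, rfl⟩ := Finset.mem_image.1 hv
              exact hcon x hx y hy)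
          linarith)
      exact ⟨f, hf, fun _ => hf2⟩
  choose π hπ hπR using hmatch
  obtain ⟨g, hg, hgR⟩ := tree_aux hTr (fun a b x y => G.Adj (p a x) (p b y))
    (fun a b x y h => h.symm) π hπ (fun a b h x => hπR a b h.ne x)
  refine ⟨Finset.univ.image (fun x : Fin m => Finset.univ.image (fun a => p a (g a x))),
    ⟨?_, ?_⟩, ?_⟩
  · intro S hS
    obtain ⟨x, _, rfl⟩ := Finset.mem_image.1 hS
    exact ⟨fun a => p a (g a x), fun a b h => (hp _ _ _ _ h).1, fun a b h => hgR a b h x, rfl⟩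
  · intro S hS S' hS' hne
    obtain ⟨x, _, rfl⟩ := Finset.mem_image.1 hS
    obtain ⟨y, _, rfl⟩ := Finset.mem_image.1 hS'
    rw [Finset.disjoint_left]
    intro v hv hv'
    obtain ⟨a, _, rfl⟩ := Finset.mem_image.1 hv
    obtain ⟨b, _, hb⟩ := Finset.mem_image.1 hv'
    obtain ⟨rfl, h2⟩ := hp _ _ _ _ hb
    have := hg _ h2
    subst this
    exact hne rfl
  · ext v
    simp only [Finset.mem_univ, iff_true, Finset.mem_biUnion]
    obtain ⟨i, b, rfl⟩ := hps v
    obtain ⟨x, rfl⟩ := (Finite.injective_iff_surjective.1 (hg i)) b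
    exact ⟨_, Finset.mem_image_of_mem _ (Finset.mem_univ x),
      Finset.mem_image.2 ⟨i, Finset.mem_univ _, rfl⟩⟩
end
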